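/- arXiv:1304.3595 — 6 statements merged into one kernel-verified Lean document; each statement's English description precedes it below -/
import Mathlib

section
/- (Muckenhoupt's criterion.) Let m be a median of μ and define B_m⁺ := sup_{x ≥ m} (∫_x^{+∞} e^{−U(y)} dy)·(∫_m^x e^{U(y)} dy), B_m⁻ := sup_{x ≤ m} (∫_{−∞}^x e^{−U(y)} dy)·(∫_x^m e^{U(y)} dy), and B_m := max(B_m⁺, B_m⁻). If B_m < ∞, then: (i) for every smooth compactly supported f : ℝ → ℝ, Var_μ(f) ≤ 4 B_m ∫_ℝ f'(x)² dμ(x); and (ii) for every constant c > 0 such that c·Var_μ(f) ≤ ∫ f'² dμ for all smooth compactly supported f, one has c ≤ 2/B_m. In other words, 1/(4B_m) ≤ λ₁ ≤ 2/B_m where λ₁ is the spectral gap. -/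
open MeasureTheory
open scoped ENNReal

/-- The probability measure with density `e^{−U}` w.r.t. Lebesgue measure. -/
noncomputable def muU (U : ℝ → ℝ) : Measure ℝ :=
  volume.withDensity (fun x => ENNReal.ofReal (Real.exp (-U x)))

/-- The variance `Var_μ(f) = ∫ f² dμ − (∫ f dμ)²`. -/
noncomputable def varMu (μ : Measure ℝ) (f : ℝ → ℝ) : ℝ :=
  (∫ x, f x ^ 2 ∂μ) - (∫ x, f x ∂μ) ^ 2

/-- Muckenhoupt's quantity `B_m⁺ = sup_{x ≥ m} (∫_x^∞ e^{−U})(∫_m^x e^U)`. -/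
noncomputable def Bplus (U : ℝ → ℝ) (m : ℝ) : ℝ :=
  sSup ((fun x => (∫ y in Set.Ioi x, Real.exp (-U y)) * ∫ y in m..x, Real.exp (U y)) ''
    Set.Ici m)

/-- Muckenhoupt's quantity `B_m⁻ = sup_{x ≤ m} (∫_{−∞}^x e^{−U})(∫_x^m e^U)`. -/
noncomputable def Bminus (U : ℝ → ℝ) (m : ℝ) : ℝ :=
  sSup ((fun x => (∫ y in Set.Iic x, Real.exp (-U y)) * ∫ y in x..m, Real.exp (U y)) ''
    Set.Iic m)

/-- Muckenhoupt's quantity `B_m = max(B_m⁺, B_m⁻)`. -/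
noncomputable def Bmuck (U : ℝ → ℝ) (m : ℝ) : ℝ := max (Bplus U m) (Bminus U m)

section Helpers

open Set Filter Topology

section Hardy

variable {U f : ℝ → ℝ} {m B : ℝ}

/-- The tail `∫_x^∞ e^{-U}` is an antiderivative of `-e^{-U}`. -/
lemma hasDerivAt_tail (hU : Continuous U) (hi : Integrable fun x => Real.exp (-U x)) (x : ℝ) :
    HasDerivAt (fun x => ∫ y in Ioi x, Real.exp (-U y)) (-Real.exp (-U x)) x := by
  have hc : Continuous fun x => Real.exp (-U x) := by fun_prop
  have h1 : (fun x => ∫ y in Ioi x, Real.exp (-U y)) =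
      fun x => (∫ y in Ioi (0 : ℝ), Real.exp (-U y)) - ∫ y in (0 : ℝ)..x, Real.exp (-U y) := by
    funext t
    have := intervalIntegral.integral_Ioi_sub_Ioi' (a := 0) (b := t)
      hi.integrableOn hi.integrableOn
    linarith
  rw [h1]
  exact (hc.integral_hasStrictDerivAt 0 x).hasDerivAt.const_sub _

/-- A function vanishing at `m` and differentiable there satisfies `f² / h → 0` at `m` when `h`
vanishes at `m` with nonzero derivative. -/
lemma continuousAt_sq_div {f h : ℝ → ℝ} {m f' h' : ℝ} (hf : HasDerivAt f f' m)
    (hh : HasDerivAt h h' m) (hfm : f m = 0) (hhm : h m = 0) (hh' : h' ≠ 0) :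
    ContinuousAt (fun x => f x ^ 2 / h x) m := by
  rw [continuousAt_iff_punctured_nhds]
  have h1 := (hasDerivAt_iff_tendsto_slope.1 hf)
  have h2 := (hasDerivAt_iff_tendsto_slope.1 hh)
  have h3 : Tendsto f (𝓝[≠] m) (𝓝 0) := by
    simpa [hfm] using hf.continuousAt.tendsto.mono_left nhdsWithin_le_nhds
  have h4 := h3.mul (h1.div h2 hh')
  simp only [hfm, hhm, zero_mul, div_zero] at h4 ⊢
  refine h4.congr' ?_
  filter_upwards [self_mem_nhdsWithin] with x hx
  have hx' : x - m ≠ 0 := sub_ne_zero.2 hx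
  simp only [Pi.div_apply, slope_def_field, hfm, hhm, sub_zero]
  rw [div_div_div_cancel_right₀ hx', sq, mul_div_assoc]

/-- Muckenhoupt's weighted Hardy inequality on a bounded interval. -/
lemma hardy_interval (hU : Continuous U) (hi : Integrable fun x => Real.exp (-U x))
    (hB : ∀ x, m ≤ x → (∫ y in Ioi x, Real.exp (-U y)) * (∫ y in m..x, Real.exp (U y)) ≤ B)
    (hf : ContDiff ℝ 1 f) (hfm : f m = 0) {b : ℝ} (hb : m ≤ b) :
    ∫ x in m..b, f x ^ 2 * Real.exp (-U x) ≤
      4 * B * ∫ x in m..b, deriv f x ^ 2 * Real.exp (-U x) := by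
  have hf' : Continuous (deriv f) := hf.continuous_deriv le_rfl
  have hfc : Continuous f := hf.continuous
  have hfd : ∀ x, HasDerivAt f (deriv f x) x := fun x =>
    (hf.differentiable one_ne_zero x).hasDerivAt
  set T : ℝ → ℝ := fun x => ∫ y in Ioi x, Real.exp (-U y) with hT
  set h : ℝ → ℝ := fun x => ∫ y in m..x, Real.exp (U y) with hh
  have hTd : ∀ x, HasDerivAt T (-Real.exp (-U x)) x := hasDerivAt_tail hU hi
  have hhd : ∀ x, HasDerivAt h (Real.exp (U x)) x := fun x =>
    ((Real.continuous_exp.comp hU).integral_hasStrictDerivAt m x).hasDerivAt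
  have hT0 : ∀ x, 0 ≤ T x := fun x => integral_nonneg fun y => (Real.exp_pos _).le
  have hhm : h m = 0 := by simp [hh]
  have hhpos : ∀ x, m < x → 0 < h x := fun x hx =>
    intervalIntegral.intervalIntegral_pos_of_pos
      ((Real.continuous_exp.comp hU).intervalIntegrable _ _) (fun y => Real.exp_pos _) hx
  have hB0 : 0 ≤ B := by simpa using hB m le_rfl
  set G1 : ℝ → ℝ := fun x => ∫ y in m..x, deriv f y ^ 2 * Real.exp (-U y) with hG1
  set G2 : ℝ → ℝ := fun x => ∫ y in m..x, f y ^ 2 * Real.exp (-U y) with hG2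
  have hG1d : ∀ x, HasDerivAt G1 (deriv f x ^ 2 * Real.exp (-U x)) x := fun x =>
    ((by fun_prop : Continuous fun y => deriv f y ^ 2 * Real.exp (-U y)).integral_hasStrictDerivAt
      m x).hasDerivAt
  have hG2d : ∀ x, HasDerivAt G2 (f x ^ 2 * Real.exp (-U x)) x := fun x =>
    ((by fun_prop : Continuous fun y => f y ^ 2 * Real.exp (-U y)).integral_hasStrictDerivAt
      m x).hasDerivAt
  set Ψ : ℝ → ℝ := fun x => 4 * B * G1 x - G2 x - (f x ^ 2 * T x + B * (f x ^ 2 / h x)) with hΨ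
  have hΨd : ∀ x, m < x → HasDerivAt Ψ (4 * B * (deriv f x ^ 2 * Real.exp (-U x))
      - f x ^ 2 * Real.exp (-U x)
      - ((2 * f x * deriv f x * T x + f x ^ 2 * (-Real.exp (-U x)))
        + B * ((2 * f x * deriv f x * h x - f x ^ 2 * Real.exp (U x)) / h x ^ 2))) x := by
    intro x hx
    have hsq : HasDerivAt (fun x => f x ^ 2) (2 * f x * deriv f x) x := by
      simpa [Pi.pow_def] using (hfd x).pow 2
    exact (((hG1d x).const_mul _).sub (hG2d x)).sub
      ((hsq.mul (hTd x)).add ((hsq.div (hhd x) (hhpos x hx).ne').const_mul B))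
  have hmono : MonotoneOn Ψ (Ici m) := by
    refine monotoneOn_of_deriv_nonneg (convex_Ici m) ?_ ?_ ?_
    · intro x hx
      rcases (mem_Ici.1 hx).eq_or_lt with rfl | hx
      · have := continuousAt_sq_div (hfd m) (hhd m) hfm hhm (Real.exp_pos _).ne'
        exact ((((hG1d m).continuousAt.const_mul _).sub (hG2d m).continuousAt).sub
          (((hfc.continuousAt.pow 2).mul (hTd m).continuousAt).add
            (this.const_mul B))).continuousWithinAt
      · exact (hΨd x hx).continuousAt.continuousWithinAt
    · intro x hx
      rw [interior_Ici] at hx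
      exact (hΨd x hx).differentiableAt.differentiableWithinAt
    · intro x hx
      rw [interior_Ici] at hx
      rw [(hΨd x hx).deriv]
      have hp := hhpos x hx
      have hle : T x * h x ≤ B := hB x (le_of_lt hx)
      have hE : 0 < Real.exp (-U x) := Real.exp_pos _
      have hEE : Real.exp (U x) = (Real.exp (-U x))⁻¹ := by rw [Real.exp_neg, inv_inv]
      rw [hEE]
      generalize Real.exp (-U x) = E at hE
      generalize deriv f x = d
      generalize f x = z
      have hTx := hT0 x
      generalize T x = t at hle hTx
      generalize h x = k at hp hle
      have key : 4 * B * (d ^ 2 * E) - z ^ 2 * E - ((2 * z * d * t + z ^ 2 * (-E))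
          + B * ((2 * z * d * k - z ^ 2 * E⁻¹) / k ^ 2)) =
          (4 * B * (d * E * k) ^ 2 - 2 * (d * E * k) * z * (t * k + B) + B * z ^ 2) /
            (E * k ^ 2) := by
        field_simp
        ring
      rw [key]
      apply div_nonneg _ (by positivity)
      generalize d * E * k = w
      have hs0 : 0 ≤ t * k := by positivity
      generalize t * k = s at hle hs0
      have h1 : 2 * w * z * (s + B) ≤ 2 * |w * z| * (2 * B) := by
        have := le_abs_self (w * z)
        have := abs_nonneg (w * z)
        nlinarith
      have h2 : 2 * (2 * |w * z|) ≤ 4 * w ^ 2 + z ^ 2 := by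
        rw [abs_mul, ← sq_abs w, ← sq_abs z]
        nlinarith [sq_nonneg (2 * |w| - |z|)]
      nlinarith
  have h0 : Ψ m = 0 := by simp [hΨ, hG1, hG2, hfm]
  have h1 : Ψ m ≤ Ψ b := hmono self_mem_Ici hb hb
  have h2 : 0 ≤ f b ^ 2 * T b + B * (f b ^ 2 / h b) := by
    have hhb : 0 ≤ h b := intervalIntegral.integral_nonneg hb fun _ _ => (Real.exp_pos _).le
    have := hT0 b
    positivity
  simp only [hΨ] at h1 h0
  linarith

/-- Muckenhoupt's weighted Hardy inequality on a half-line. -/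
lemma hardy_Ioi (hU : Continuous U) (hi : Integrable fun x => Real.exp (-U x))
    (hB : ∀ x, m ≤ x → (∫ y in Ioi x, Real.exp (-U y)) * (∫ y in m..x, Real.exp (U y)) ≤ B)
    (hf : ContDiff ℝ 1 f) (hfm : f m = 0)
    (h1 : Integrable fun x => f x ^ 2 * Real.exp (-U x))
    (h2 : Integrable fun x => deriv f x ^ 2 * Real.exp (-U x)) :
    ∫ x in Ioi m, f x ^ 2 * Real.exp (-U x) ≤
      4 * B * ∫ x in Ioi m, deriv f x ^ 2 * Real.exp (-U x) := by
  refine le_of_tendsto_of_tendsto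
    (intervalIntegral_tendsto_integral_Ioi m h1.integrableOn tendsto_id)
    ((intervalIntegral_tendsto_integral_Ioi m h2.integrableOn tendsto_id).const_mul (4 * B)) ?_
  filter_upwards [eventually_ge_atTop m] with b hb
  exact hardy_interval hU hi hB hf hfm hb

lemma hardy_Iic (hU : Continuous U) (hi : Integrable fun x => Real.exp (-U x))
    (hB : ∀ x, x ≤ m → (∫ y in Iic x, Real.exp (-U y)) * (∫ y in x..m, Real.exp (U y)) ≤ B)
    (hf : ContDiff ℝ 1 f) (hfm : f m = 0)
    (h1 : Integrable fun x => f x ^ 2 * Real.exp (-U x))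
    (h2 : Integrable fun x => deriv f x ^ 2 * Real.exp (-U x)) :
    ∫ x in Iic m, f x ^ 2 * Real.exp (-U x) ≤
      4 * B * ∫ x in Iic m, deriv f x ^ 2 * Real.exp (-U x) := by
  have hd : ∀ x, deriv (fun x => f (-x)) x = -deriv f (-x) := fun x => deriv_comp_neg f x
  have key := hardy_Ioi (U := fun x => U (-x)) (f := fun x => f (-x)) (m := -m) (B := B)
    (by fun_prop) hi.comp_neg
    (fun x hx => by
      have := hB (-x) (by linarith)
      rwa [integral_comp_neg_Ioi x fun y => Real.exp (-U y),
        intervalIntegral.integral_comp_neg fun y => Real.exp (U y), neg_neg])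
    (hf.comp contDiff_neg) (by simpa using hfm) h1.comp_neg
    (by simpa only [hd, neg_sq] using h2.comp_neg)
  simp only [hd, neg_sq] at key
  rwa [integral_comp_neg_Ioi (-m) fun x => f x ^ 2 * Real.exp (-U x),
    integral_comp_neg_Ioi (-m) fun x => deriv f x ^ 2 * Real.exp (-U x), neg_neg] at key

end Hardy

section TestFunction

variable {U : ℝ → ℝ} {c : ℝ}

/-- `c` is a Poincaré constant of the measure with density `e^{-U}`. -/
def IsPoincareConst (U : ℝ → ℝ) (c : ℝ) : Prop :=
  ∀ f : ℝ → ℝ, ContDiff ℝ (⊤ : ℕ∞) f → HasCompactSupport f →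
    c * ((∫ x, f x ^ 2 * Real.exp (-U x)) - (∫ x, f x * Real.exp (-U x)) ^ 2) ≤
      ∫ x, deriv f x ^ 2 * Real.exp (-U x)

lemma IsPoincareConst.comp_neg (h : IsPoincareConst U c) :
    IsPoincareConst (fun x => U (-x)) c := by
  intro f hf hfs
  have hd : ∀ x, deriv (fun x => f (-x)) x = -deriv f (-x) := fun x => deriv_comp_neg f x
  have := h (fun x => f (-x)) (hf.comp contDiff_neg)
    (hfs.comp_homeomorph (Homeomorph.neg ℝ))
  simp only [hd, neg_sq] at this
  rw [← integral_neg_eq_self fun x => f (-x) ^ 2 * Real.exp (-U x),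
    ← integral_neg_eq_self fun x => f (-x) * Real.exp (-U x),
    ← integral_neg_eq_self fun x => deriv f (-x) ^ 2 * Real.exp (-U x)] at this
  simpa only [neg_neg] using this

/-- Dominated convergence against an integrable weight for uniformly bounded sequences. -/
lemma tendsto_integral_mul_of_bounded {p : ℝ → ℝ} (hp : Integrable p) {F : ℕ → ℝ → ℝ}
    {g : ℝ → ℝ} (hF : ∀ n, Continuous (F n)) {M : ℝ} (hM : ∀ n x, |F n x| ≤ M)
    (hlim : ∀ x, Tendsto (fun n => F n x) atTop (𝓝 (g x))) :
    Tendsto (fun n => ∫ x, F n x * p x) atTop (𝓝 (∫ x, g x * p x)) := by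
  refine tendsto_integral_of_dominated_convergence (fun x => M * ‖p x‖)
    (fun n => (hF n).aestronglyMeasurable.mul hp.aestronglyMeasurable)
    (hp.norm.const_mul M) (fun n => ?_) ?_
  · refine Eventually.of_forall fun x => ?_
    rw [norm_mul]
    exact mul_le_mul_of_nonneg_right (hM n x) (norm_nonneg _)
  · exact Eventually.of_forall fun x => (hlim x).mul_const _

/-- A Poincaré inequality for test functions extends to smooth functions which are bounded
together with their derivative. -/
lemma IsPoincareConst.of_bounded (h : IsPoincareConst U c)
    (hi : Integrable fun x => Real.exp (-U x)) {f : ℝ → ℝ} (hf : ContDiff ℝ (⊤ : ℕ∞) f)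
    {M M' : ℝ} (hM : ∀ x, |f x| ≤ M) (hM' : ∀ x, |deriv f x| ≤ M') :
    c * ((∫ x, f x ^ 2 * Real.exp (-U x)) - (∫ x, f x * Real.exp (-U x)) ^ 2) ≤
      ∫ x, deriv f x ^ 2 * Real.exp (-U x) := by
  have hM0 : 0 ≤ M := (abs_nonneg _).trans (hM 0)
  have hM'0 : 0 ≤ M' := (abs_nonneg _).trans (hM' 0)
  let χ : ContDiffBump (0 : ℝ) := ⟨1, 2, one_pos, one_lt_two⟩
  have hχ : ContDiff ℝ (⊤ : ℕ∞) χ := χ.contDiff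
  have hχ' : Continuous (deriv χ) := hχ.continuous_deriv (by simp)
  obtain ⟨K, hK⟩ := hχ'.bounded_above_of_compact_support χ.hasCompactSupport.deriv
  have hK0 : 0 ≤ K := (norm_nonneg _).trans (hK 0)
  set r : ℕ → ℝ := fun n => 1 / ((n : ℝ) + 1) with hr
  have hr0 : ∀ n, 0 < r n := fun n => by positivity
  have hr1 : ∀ n, r n ≤ 1 := fun n => by
    rw [hr]; simp only; rw [div_le_one (by positivity)]; linarith [n.cast_nonneg (α := ℝ)]
  have hrlim : Tendsto r atTop (𝓝 0) := tendsto_one_div_add_atTop_nhds_zero_nat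
  set F : ℕ → ℝ → ℝ := fun n x => f x * χ (r n * x) with hF
  have hFs : ∀ n, ContDiff ℝ (⊤ : ℕ∞) (F n) := fun n =>
    hf.mul (hχ.comp (contDiff_const.mul contDiff_id))
  have hFc : ∀ n, HasCompactSupport (F n) := fun n => by
    have : HasCompactSupport fun x => χ (r n * x) :=
      χ.hasCompactSupport.comp_homeomorph (Homeomorph.mulLeft₀ (r n) (hr0 n).ne')
    exact this.mul_left
  have hFd : ∀ n x, deriv (F n) x =
      deriv f x * χ (r n * x) + f x * (r n * deriv χ (r n * x)) := by
    intro n x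
    have h1 : HasDerivAt f (deriv f x) x := (hf.differentiable (by simp) x).hasDerivAt
    have h2 : HasDerivAt χ (deriv χ (r n * x)) (r n * x) :=
      (hχ.differentiable (by simp) _).hasDerivAt
    have h3 : HasDerivAt (fun x => r n * x) (r n) x := by
      simpa using (hasDerivAt_id x).const_mul (r n)
    have h4 : HasDerivAt (fun x => χ (r n * x)) (deriv χ (r n * x) * r n) x := h2.comp x h3
    rw [show F n = f * fun x => χ (r n * x) from rfl, (h1.mul h4).deriv]
    ring
  have hrx : ∀ x, Tendsto (fun n => r n * x) atTop (𝓝 0) := fun x => by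
    simpa using hrlim.mul_const x
  have hχ0 : χ (0 : ℝ) = 1 := χ.one_of_mem_closedBall (by simp [χ])
  have hχlim : ∀ x, Tendsto (fun n => χ (r n * x)) atTop (𝓝 1) := fun x => by
    simpa only [hχ0, Function.comp_def] using (hχ.continuous.tendsto 0).comp (hrx x)
  have hFlim : ∀ x, Tendsto (fun n => F n x) atTop (𝓝 (f x)) := fun x => by
    simpa using (hχlim x).const_mul (f x)
  have hFdlim : ∀ x, Tendsto (fun n => deriv (F n) x) atTop (𝓝 (deriv f x)) := fun x => by
    simp only [hFd]
    simpa using ((hχlim x).const_mul (deriv f x)).add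
      ((hrlim.mul ((hχ'.tendsto 0).comp (hrx x))).const_mul (f x))
  have hχa : ∀ y, |χ y| ≤ 1 := fun y => abs_le.2 ⟨by linarith [χ.nonneg' y], χ.le_one⟩
  have hFM : ∀ n x, |F n x| ≤ M := fun n x => by
    rw [abs_mul]
    simpa using mul_le_mul (hM x) (hχa _) (abs_nonneg _) hM0
  have hFM' : ∀ n x, |deriv (F n) x| ≤ M' + M * K := fun n x => by
    rw [hFd]
    refine (abs_add_le _ _).trans (add_le_add ?_ ?_)
    · rw [abs_mul]
      simpa using mul_le_mul (hM' x) (hχa _) (abs_nonneg _) hM'0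
    · rw [abs_mul, abs_mul, abs_of_pos (hr0 n)]
      refine mul_le_mul (hM x) ?_ (by have := (hr0 n).le; positivity) hM0
      simpa using mul_le_mul (hr1 n) (hK _) (abs_nonneg _) zero_le_one
  have hsq : ∀ {a b : ℝ}, |a| ≤ b → |a ^ 2| ≤ b ^ 2 := fun {a b} hab => by
    rw [abs_pow]; exact pow_le_pow_left₀ (abs_nonneg _) hab 2
  have L1 := tendsto_integral_mul_of_bounded hi (F := fun n x => F n x ^ 2)
    (fun n => (hFs n).continuous.pow 2) (fun n x => hsq (hFM n x)) (fun x => (hFlim x).pow 2)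
  have L2 := tendsto_integral_mul_of_bounded hi (F := F)
    (fun n => (hFs n).continuous) hFM hFlim
  have L3 := tendsto_integral_mul_of_bounded hi (F := fun n x => deriv (F n) x ^ 2)
    (fun n => ((hFs n).continuous_deriv (by simp)).pow 2) (fun n x => hsq (hFM' n x))
    (fun x => (hFdlim x).pow 2)
  exact le_of_tendsto_of_tendsto' ((L1.sub (L2.pow 2)).const_mul c) L3
    fun n => h (F n) (hFs n) (hFc n)

lemma integrable_mul_of_bounded {p g : ℝ → ℝ} (hp : Integrable p) (hg : Continuous g) {M : ℝ}
    (hM : ∀ x, |g x| ≤ M) : Integrable fun x => g x * p x :=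
  hp.bdd_mul hg.aestronglyMeasurable (Eventually.of_forall hM)

/-- The mean of a function supported in a half-line of mass at most `1/2` satisfies
`(∫ f)² ≤ (1/2) ∫ f²`. -/
lemma sq_integral_le_half {p f : ℝ → ℝ} {m : ℝ} (hp : Integrable p) (hp0 : ∀ x, 0 ≤ p x)
    (hmass : ∫ x in Ioi m, p x ≤ 1 / 2) (hfm : ∀ x, x ≤ m → f x = 0)
    (h1 : Integrable fun x => f x * p x) (h2 : Integrable fun x => f x ^ 2 * p x) :
    (∫ x, f x * p x) ^ 2 ≤ 1 / 2 * ∫ x, f x ^ 2 * p x := by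
  rw [← setIntegral_eq_integral_of_forall_compl_eq_zero (s := Ioi m) (f := fun x => f x * p x)
      (fun x hx => by simp [hfm x (not_lt.1 hx)]),
    ← setIntegral_eq_integral_of_forall_compl_eq_zero (s := Ioi m)
      (f := fun x => f x ^ 2 * p x) (fun x hx => by simp [hfm x (not_lt.1 hx)])]
  set a := ∫ x in Ioi m, f x * p x with ha
  have h0 : 0 ≤ ∫ x in Ioi m, (f x - 2 * a) ^ 2 * p x :=
    integral_nonneg fun x => mul_nonneg (sq_nonneg _) (hp0 x)
  have e : ∫ x in Ioi m, (f x - 2 * a) ^ 2 * p x =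
      (∫ x in Ioi m, f x ^ 2 * p x) - 4 * a * a + 4 * a ^ 2 * ∫ x in Ioi m, p x := by
    have I1 : IntegrableOn (fun x => 4 * a * (f x * p x)) (Ioi m) := (h1.const_mul _).integrableOn
    have I2 : IntegrableOn (fun x => 4 * a ^ 2 * p x) (Ioi m) := (hp.const_mul _).integrableOn
    have I3 : IntegrableOn (fun x => f x ^ 2 * p x - 4 * a * (f x * p x)) (Ioi m) :=
      h2.integrableOn.sub I1
    have e1 : ∫ x in Ioi m, 4 * a * (f x * p x) = 4 * a * a := integral_const_mul _ _
    have e2 : ∫ x in Ioi m, 4 * a ^ 2 * p x = 4 * a ^ 2 * ∫ x in Ioi m, p x :=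
      integral_const_mul _ _
    rw [← e1, ← e2, ← integral_sub h2.integrableOn I1, ← integral_add I3 I2]
    exact integral_congr_ae (Eventually.of_forall fun x => by simp only; ring)
  nlinarith [sq_nonneg a]

/-- Testing the Poincaré inequality against a smooth approximation of
`t ↦ ∫_m^{t ∧ x} e^U`, with derivative `φ e^U`. -/
lemma IsPoincareConst.bump_le (h : IsPoincareConst U c) (hc : 0 < c)
    (hU : ContDiff ℝ (⊤ : ℕ∞) U) (hi : Integrable fun x => Real.exp (-U x)) {m x : ℝ}
    (hmx : m ≤ x) (hmass : ∫ y in Ioi m, Real.exp (-U y) ≤ 1 / 2) {φ : ℝ → ℝ}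
    (hφ : ContDiff ℝ (⊤ : ℕ∞) φ) (hφ0 : ∀ t, 0 ≤ φ t) (hφ1 : ∀ t, φ t ≤ 1)
    (hφs : ∀ t, t ∉ Ioo m x → φ t = 0) :
    c * ((∫ y in Ioi x, Real.exp (-U y)) * ∫ y in m..x, φ y * Real.exp (U y)) ≤ 2 := by
  have hUc := hU.continuous
  have hg : ContDiff ℝ (⊤ : ℕ∞) fun y => φ y * Real.exp (U y) := hφ.mul hU.exp
  set f : ℝ → ℝ := fun t => ∫ y in m..t, φ y * Real.exp (U y) with hf
  have hfd : ∀ t, HasDerivAt f (φ t * Real.exp (U t)) t := fun t =>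
    (hg.continuous.integral_hasStrictDerivAt m t).hasDerivAt
  have hfd' : deriv f = fun t => φ t * Real.exp (U t) := funext fun t => (hfd t).deriv
  have hfs : ContDiff ℝ (⊤ : ℕ∞) f :=
    contDiff_infty_iff_deriv.2 ⟨fun t => (hfd t).differentiableAt, by rwa [hfd']⟩
  have hf0 : ∀ t, t ≤ m → f t = 0 := fun t ht => by
    refine intervalIntegral.integral_zero_ae (Eventually.of_forall fun y hy => ?_)
    rw [uIoc_of_ge ht] at hy
    simp [hφs y fun hy' => absurd hy'.1 (not_lt.2 hy.2)]
  have hfx : ∀ t, x ≤ t → f t = f x := fun t ht => by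
    have e := intervalIntegral.integral_add_adjacent_intervals
      (hg.continuous.intervalIntegrable (μ := volume) m x)
      (hg.continuous.intervalIntegrable (μ := volume) x t)
    have z : ∫ y in x..t, φ y * Real.exp (U y) = 0 := by
      refine intervalIntegral.integral_zero_ae (Eventually.of_forall fun y hy => ?_)
      rw [uIoc_of_le ht] at hy
      simp [hφs y fun hy' => absurd hy'.2 (not_lt.2 hy.1.le)]
    simp only [hf]
    linarith
  have hmono : Monotone f := monotone_of_deriv_nonneg (hfs.differentiable (by simp)) fun t => by
    rw [hfd']
    exact mul_nonneg (hφ0 t) (Real.exp_pos _).le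
  have hfnn : ∀ t, 0 ≤ f t := fun t => by
    rcases le_total t m with ht | ht
    · exact (hf0 t ht).ge
    · exact (hf0 m le_rfl).ge.trans (hmono ht)
  have hfle : ∀ t, f t ≤ f x := fun t => by
    rcases le_total t x with ht | ht
    · exact hmono ht
    · exact (hfx t ht).le
  have hfM : ∀ t, |f t| ≤ f x := fun t => by rw [abs_of_nonneg (hfnn t)]; exact hfle t
  have hdc : HasCompactSupport (deriv f) := by
    refine HasCompactSupport.intro (isCompact_Icc (a := m) (b := x)) fun t ht => ?_
    rw [hfd']
    simp [hφs t fun h => ht (Ioo_subset_Icc_self h)]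
  have hd'c : Continuous (deriv f) := by rw [hfd']; exact hg.continuous
  obtain ⟨M', hM'⟩ := hd'c.bounded_above_of_compact_support hdc
  have hP := h.of_bounded hi hfs hfM hM'
  have hI2 : Integrable fun t => f t ^ 2 * Real.exp (-U t) :=
    integrable_mul_of_bounded hi (hfs.continuous.pow 2) (M := f x ^ 2) fun t => by
      rw [abs_pow]; exact pow_le_pow_left₀ (abs_nonneg _) (hfM t) 2
  have hhalf := sq_integral_le_half hi (fun t => (Real.exp_pos _).le) hmass hf0
    (integrable_mul_of_bounded hi hfs.continuous hfM) hI2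
  have hlow : f x ^ 2 * ∫ y in Ioi x, Real.exp (-U y) ≤ ∫ t, f t ^ 2 * Real.exp (-U t) := by
    rw [← integral_const_mul]
    calc ∫ y in Ioi x, f x ^ 2 * Real.exp (-U y) = ∫ y in Ioi x, f y ^ 2 * Real.exp (-U y) :=
          setIntegral_congr_fun measurableSet_Ioi fun y hy => by
            simp only [hfx y (le_of_lt hy)]
      _ ≤ _ := setIntegral_le_integral hI2
          (Eventually.of_forall fun t => mul_nonneg (sq_nonneg _) (Real.exp_pos _).le)
  have henergy : ∫ t, deriv f t ^ 2 * Real.exp (-U t) ≤ f x := by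
    have e : (fun t => deriv f t ^ 2 * Real.exp (-U t)) = fun t => φ t ^ 2 * Real.exp (U t) := by
      funext t
      rw [hfd']
      have : Real.exp (U t) * Real.exp (-U t) = 1 := by rw [← Real.exp_add]; simp
      calc _ = φ t ^ 2 * Real.exp (U t) * (Real.exp (U t) * Real.exp (-U t)) := by ring
        _ = _ := by rw [this, mul_one]
    rw [e, ← setIntegral_eq_integral_of_forall_compl_eq_zero (s := Ioc m x)
      (fun t ht => by simp [hφs t fun h => ht (Ioo_subset_Ioc_self h)]),
      ← intervalIntegral.integral_of_le hmx]
    have hφc := hφ.continuous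
    refine intervalIntegral.integral_mono_on hmx (Continuous.intervalIntegrable (by fun_prop) _ _)
      (hg.continuous.intervalIntegrable _ _) fun t _ => ?_
    have : φ t ^ 2 ≤ φ t := by nlinarith [hφ0 t, hφ1 t]
    exact mul_le_mul_of_nonneg_right this (Real.exp_pos _).le
  change c * (_ * f x) ≤ 2
  set T := ∫ y in Ioi x, Real.exp (-U y)
  set I := ∫ t, f t ^ 2 * Real.exp (-U t)
  have h1 : c * (1 / 2 * (f x ^ 2 * T)) ≤ f x := by
    refine le_trans (mul_le_mul_of_nonneg_left ?_ hc.le) (hP.trans henergy)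
    linarith
  rcases (hfnn x).eq_or_lt with h0 | h0
  · rw [← h0]; simp
  · by_contra! hlt
    nlinarith

/-- A Poincaré constant is at most `2` over Muckenhoupt's quantity at each point right of `m`. -/
lemma IsPoincareConst.mul_le_two (h : IsPoincareConst U c) (hc : 0 < c)
    (hU : ContDiff ℝ (⊤ : ℕ∞) U) (hi : Integrable fun x => Real.exp (-U x)) {m x : ℝ}
    (hmx : m ≤ x) (hmass : ∫ y in Ioi m, Real.exp (-U y) ≤ 1 / 2) :
    c * ((∫ y in Ioi x, Real.exp (-U y)) * ∫ y in m..x, Real.exp (U y)) ≤ 2 := by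
  rcases hmx.eq_or_lt with rfl | hlt
  · simp
  have hUc := hU.continuous
  have hec : Continuous fun y => Real.exp (U y) := by fun_prop
  have hT0 : 0 ≤ ∫ y in Ioi x, Real.exp (-U y) := integral_nonneg fun y => (Real.exp_pos _).le
  have hcont : Continuous fun ε : ℝ => c * ((∫ y in Ioi x, Real.exp (-U y)) *
      ((∫ y in m..(x - ε), Real.exp (U y)) - ∫ y in m..(m + ε), Real.exp (U y))) := by
    have := intervalIntegral.continuous_primitive (μ := volume)
      (fun a b => hec.intervalIntegrable a b) m
    fun_prop
  have hlim := (hcont.tendsto 0).mono_left (nhdsWithin_le_nhds (s := Ioi 0))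
  simp only [sub_zero, add_zero, intervalIntegral.integral_same] at hlim
  refine le_of_tendsto hlim ?_
  filter_upwards [Ioo_mem_nhdsGT (show (0 : ℝ) < (x - m) / 2 by linarith)] with ε hε
  obtain ⟨hε0, hε1⟩ := hε
  let φ : ContDiffBump ((m + x) / 2) :=
    ⟨(x - m) / 2 - ε, (x - m) / 2, by linarith, by linarith⟩
  refine le_trans (mul_le_mul_of_nonneg_left (mul_le_mul_of_nonneg_left ?_ hT0) hc.le)
    (h.bump_le hc hU hi hmx hmass φ.contDiff (fun t => φ.nonneg' t) (fun t => φ.le_one)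
      fun t ht => ?_)
  · have hφc : Continuous φ := φ.contDiff.continuous (n := 0)
    rw [intervalIntegral.integral_interval_sub_left (hec.intervalIntegrable _ _)
      (hec.intervalIntegrable _ _)]
    calc ∫ y in (m + ε)..(x - ε), Real.exp (U y)
        = ∫ y in (m + ε)..(x - ε), φ y * Real.exp (U y) := by
          refine intervalIntegral.integral_congr fun y hy => ?_
          rw [uIcc_of_le (by linarith)] at hy
          have : φ y = 1 := φ.one_of_mem_closedBall (by
            rw [Real.closedBall_eq_Icc]
            constructor <;> simp only [φ] <;> linarith [hy.1, hy.2])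
          simp [this]
      _ ≤ ∫ y in m..x, φ y * Real.exp (U y) :=
          intervalIntegral.integral_mono_interval (by linarith) (by linarith) (by linarith)
            (Eventually.of_forall fun y => mul_nonneg (φ.nonneg' y) (Real.exp_pos _).le)
            (Continuous.intervalIntegrable (by fun_prop) _ _)
  · refine φ.zero_of_le_dist ?_
    by_contra! hd
    rw [Real.dist_eq, abs_lt] at hd
    simp only [φ] at hd
    exact ht ⟨by linarith [hd.1], by linarith [hd.2]⟩

end TestFunction

section MuU

variable {U : ℝ → ℝ}

lemma integral_muU (hU : Continuous U) (f : ℝ → ℝ) :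
    ∫ x, f x ∂muU U = ∫ x, f x * Real.exp (-U x) := by
  rw [muU, integral_withDensity_eq_integral_toReal_smul (by fun_prop) (by simp)]
  simp [ENNReal.toReal_ofReal (Real.exp_pos _).le, mul_comm]

lemma integrable_exp_neg (hU : Continuous U) [IsFiniteMeasure (muU U)] :
    Integrable fun x => Real.exp (-U x) := by
  refine ⟨(by fun_prop : Continuous fun x => Real.exp (-U x)).aestronglyMeasurable, ?_⟩
  rw [hasFiniteIntegral_iff_ofReal (Eventually.of_forall fun x => (Real.exp_pos _).le)]
  simpa [muU] using measure_lt_top (muU U) univ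

lemma measureReal_muU (hU : Continuous U) {s : Set ℝ} (hs : MeasurableSet s) :
    (muU U).real s = ∫ x in s, Real.exp (-U x) := by
  rw [measureReal_def, muU, withDensity_apply _ hs,
    integral_eq_lintegral_of_nonneg_ae (Eventually.of_forall fun x => (Real.exp_pos _).le)
      (by fun_prop : Continuous fun x => Real.exp (-U x)).aestronglyMeasurable]

lemma half_le_measureReal {μ : Measure ℝ} [IsFiniteMeasure μ] {s : Set ℝ}
    (h : (1 : ℝ≥0∞) / 2 ≤ μ s) : 1 / 2 ≤ μ.real s := by
  simpa [measureReal_def] using ENNReal.toReal_mono (measure_ne_top μ s) h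

/-- The variance is at most the mean square deviation from any constant. -/
lemma varMu_le_integral_sub_sq {μ : Measure ℝ} [IsProbabilityMeasure μ] {f : ℝ → ℝ}
    (h1 : Integrable f μ) (h2 : Integrable (fun x => f x ^ 2) μ) (a : ℝ) :
    varMu μ f ≤ ∫ x, (f x - a) ^ 2 ∂μ := by
  have e : ∫ x, (f x - a) ^ 2 ∂μ = (∫ x, f x ^ 2 ∂μ) - 2 * a * (∫ x, f x ∂μ) + a ^ 2 := by
    have I1 : Integrable (fun x => f x ^ 2 - 2 * a * f x) μ := h2.sub (h1.const_mul _)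
    have e1 : ∫ _, a ^ 2 ∂μ = a ^ 2 := by simp
    rw [← e1, ← integral_const_mul, ← integral_sub h2 (h1.const_mul _),
      ← integral_add I1 (integrable_const _)]
    exact integral_congr_ae (Eventually.of_forall fun x => by simp only; ring)
  rw [e, varMu]
  nlinarith [sq_nonneg ((∫ x, f x ∂μ) - a)]

end MuU

end Helpers

/-- Muckenhoupt's criterion: if `B_m` is finite, then (i) the Poincaré inequality
`Var_μ(f) ≤ 4 B_m ∫ (f')² dμ` holds, and (ii) any Poincaré constant `c > 0` satisfies
`c ≤ 2/B_m`; in other words `1/(4B_m) ≤ λ₁ ≤ 2/B_m`. -/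
theorem muckenhoupt_criterion
    (U : ℝ → ℝ) (m : ℝ)
    (hU : ContDiff ℝ (⊤ : ℕ∞) U)
    (hprob : IsProbabilityMeasure (muU U))
    (hmed₁ : (1:ℝ≥0∞)/2 ≤ muU U (Set.Iic m))
    (hmed₂ : (1:ℝ≥0∞)/2 ≤ muU U (Set.Ici m))
    (hBp : BddAbove ((fun x => (∫ y in Set.Ioi x, Real.exp (-U y)) *
      ∫ y in m..x, Real.exp (U y)) '' Set.Ici m))
    (hBm : BddAbove ((fun x => (∫ y in Set.Iic x, Real.exp (-U y)) *
      ∫ y in x..m, Real.exp (U y)) '' Set.Iic m)) :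
    (∀ f : ℝ → ℝ, ContDiff ℝ (⊤ : ℕ∞) f → HasCompactSupport f →
      varMu (muU U) f ≤ 4 * Bmuck U m * ∫ x, deriv f x ^ 2 ∂(muU U))
    ∧ (∀ c : ℝ, 0 < c →
        (∀ f : ℝ → ℝ, ContDiff ℝ (⊤ : ℕ∞) f → HasCompactSupport f →
          c * varMu (muU U) f ≤ ∫ x, deriv f x ^ 2 ∂(muU U)) →
        c ≤ 2 / Bmuck U m) := by
  have hUc := hU.continuous
  have hi := integrable_exp_neg hUc
  have hle1 : ∀ x, m ≤ x → (∫ y in Set.Ioi x, Real.exp (-U y)) *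
      (∫ y in m..x, Real.exp (U y)) ≤ Bmuck U m := fun x hx =>
    (le_csSup hBp ⟨x, hx, rfl⟩).trans (le_max_left _ _)
  have hle2 : ∀ x, x ≤ m → (∫ y in Set.Iic x, Real.exp (-U y)) *
      (∫ y in x..m, Real.exp (U y)) ≤ Bmuck U m := fun x hx =>
    (le_csSup hBm ⟨x, hx, rfl⟩).trans (le_max_right _ _)
  refine ⟨fun f hf hfs => ?_, fun c hc h => ?_⟩
  · have hfc := hf.continuous
    have hf'c : Continuous (deriv f) := hf.continuous_deriv (by simp)
    obtain ⟨M, hM⟩ := hfc.bounded_above_of_compact_support hfs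
    obtain ⟨M', hM'⟩ := hf'c.bounded_above_of_compact_support hfs.deriv
    have I1 : Integrable f (muU U) :=
      .of_bound hfc.aestronglyMeasurable M (Filter.Eventually.of_forall hM)
    have I2 : Integrable (fun x => f x ^ 2) (muU U) :=
      .of_bound (hfc.pow 2).aestronglyMeasurable (M ^ 2) (Filter.Eventually.of_forall fun x => by
        rw [norm_pow]; exact pow_le_pow_left₀ (norm_nonneg _) (hM x) 2)
    refine (varMu_le_integral_sub_sq I1 I2 (f m)).trans ?_
    rw [integral_muU hUc, integral_muU hUc]
    have J1 : Integrable fun x => (f x - f m) ^ 2 * Real.exp (-U x) :=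
      integrable_mul_of_bounded hi (by fun_prop) (M := (M + M) ^ 2) fun x => by
        rw [abs_pow]
        exact pow_le_pow_left₀ (abs_nonneg _)
          ((abs_sub _ _).trans (add_le_add (hM x) (hM m))) 2
    have J2 : Integrable fun x => deriv f x ^ 2 * Real.exp (-U x) :=
      integrable_mul_of_bounded hi (by fun_prop) (M := M' ^ 2) fun x => by
        rw [abs_pow]; exact pow_le_pow_left₀ (abs_nonneg _) (hM' x) 2
    have hd : deriv (fun x => f x - f m) = deriv f := funext fun x => deriv_sub_const _
    have hfC : ContDiff ℝ 1 fun x => f x - f m := (hf.of_le (by simp)).sub contDiff_const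
    have K1 := hardy_Ioi hUc hi hle1 hfC (sub_self _) J1 (by rwa [hd])
    have K2 := hardy_Iic hUc hi hle2 hfC (sub_self _) J1 (by rwa [hd])
    rw [hd] at K1 K2
    rw [← intervalIntegral.integral_Iic_add_Ioi (b := m) J1.integrableOn J1.integrableOn,
      ← intervalIntegral.integral_Iic_add_Ioi (b := m) J2.integrableOn J2.integrableOn]
    linarith
  · have hP : IsPoincareConst U c := fun f hf hfs => by
      simpa only [varMu, integral_muU hUc] using h f hf hfs
    have htot : ∫ x, Real.exp (-U x) = 1 := by
      have := measureReal_muU hUc MeasurableSet.univ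
      rw [setIntegral_univ] at this
      rw [← this, probReal_univ]
    have hL := half_le_measureReal hmed₁
    have hR := half_le_measureReal hmed₂
    rw [measureReal_muU hUc measurableSet_Iic] at hL
    rw [measureReal_muU hUc measurableSet_Ici, integral_Ici_eq_integral_Ioi] at hR
    have hsum := intervalIntegral.integral_Iic_add_Ioi (b := m) hi.integrableOn hi.integrableOn
    have hpos : 0 < Bmuck U m := by
      refine lt_of_lt_of_le (mul_pos ?_ ?_) (hle1 (m + 1) (by linarith))
      · rw [setIntegral_pos_iff_support_of_nonneg_ae
          (Filter.Eventually.of_forall fun x => (Real.exp_pos _).le) hi.integrableOn]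
        simp [Function.support, (Real.exp_pos _).ne']
      · exact intervalIntegral.intervalIntegral_pos_of_pos
          ((Real.continuous_exp.comp hUc).intervalIntegrable _ _) (fun y => Real.exp_pos _)
          (by linarith)
    rw [le_div_iff₀ hpos, mul_comm, ← le_div_iff₀ hc]
    refine max_le (csSup_le (Set.nonempty_Ici.image _) ?_) (csSup_le (Set.nonempty_Iic.image _) ?_)
    · rintro _ ⟨x, hx, rfl⟩
      rw [le_div_iff₀ hc, mul_comm]
      exact hP.mul_le_two hc hU hi hx (by linarith)
    · rintro _ ⟨x, hx, rfl⟩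
      rw [le_div_iff₀ hc, mul_comm]
      have := hP.comp_neg.mul_le_two hc (hU.comp contDiff_neg) hi.comp_neg
        (neg_le_neg (Set.mem_Iic.1 hx)) (by
          rw [integral_comp_neg_Ioi (-m) fun y => Real.exp (-U y), neg_neg]; linarith)
      rwa [integral_comp_neg_Ioi (-x) fun y => Real.exp (-U y),
        intervalIntegral.integral_comp_neg fun y => Real.exp (U y), neg_neg, neg_neg] at this
end

section
/- (Reduction to monotone functions for the spectral gap.) Assume V_σ is bounded from below on ℝ and μ is a probability measure. For a smooth compactly supported f : ℝ → ℝ, let v_f(x) := ∫_0^x |f'(t)| dt be its total variation function. Then Var_μ(f) ≤ Var_μ(v_f). Consequently, the infimum defining the spectral gap λ₁ = inf ∫σ²(f')²dμ / Var_μ(f) is unchanged when restricted to monotone functions. -/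
open MeasureTheory

/-- The Sturm–Liouville operator `L f = σ² f'' + b f'`. -/
noncomputable def Lop (σ b f : ℝ → ℝ) : ℝ → ℝ :=
  fun x => σ x ^ 2 * deriv (deriv f) x + b x * deriv f x

/-- The drift `b_a = 2σσ' + b − 2σ² a'/a` of the dual operator `L_a`. -/
noncomputable def driftA (σ b a : ℝ → ℝ) : ℝ → ℝ :=
  fun x => 2 * σ x * deriv σ x + b x - 2 * σ x ^ 2 * deriv a x / a x

/-- The Feynman–Kac potential `V_a = L_a(a)/a − b'`. -/
noncomputable def potV (σ b a : ℝ → ℝ) : ℝ → ℝ :=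
  fun x => Lop σ (driftA σ b a) a x / a x - deriv b x

/-- The potential `U(x) = U(0) − ∫_0^x b/σ²`. -/
noncomputable def Upot (σ b : ℝ → ℝ) (U0 : ℝ) : ℝ → ℝ :=
  fun x => U0 - ∫ u in (0:ℝ)..x, b u / σ u ^ 2

/-- The reversible measure `μ` with density `e^{−U}/σ²` w.r.t. Lebesgue measure. -/
noncomputable def muMeas (σ b : ℝ → ℝ) (U0 : ℝ) : Measure ℝ :=
  volume.withDensity (fun x => ENNReal.ofReal (Real.exp (-(Upot σ b U0 x)) / σ x ^ 2))

/-- A continuous function which is pointwise dominated in increments by a bounded continuous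
function has smaller variance. -/
lemma varMu_le_varMu_of_abs_sub_le {μ : Measure ℝ} [IsProbabilityMeasure μ] {f v : ℝ → ℝ}
    (hf : Continuous f) (hv : Continuous v) {C : ℝ} (hC : ∀ x, |v x| ≤ C)
    (h : ∀ x y, |f x - f y| ≤ |v x - v y|) : varMu μ f ≤ varMu μ v := by
  have integrable_of_bounded : ∀ {g : ℝ → ℝ} {D : ℝ}, Continuous g → (∀ x, |g x| ≤ D) →
      Integrable g μ := fun {g D} hg hD =>
    Integrable.of_bound hg.aestronglyMeasurable D (Filter.Eventually.of_forall hD)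
  have hfC : ∀ x, |f x| ≤ |f 0| + 2 * C := fun x => by
    have h₁ := h x 0
    have h₂ := abs_sub (v x) (v 0)
    have h₃ := abs_sub_abs_le_abs_sub (f x) (f 0)
    linarith [hC x, hC 0]
  have sq_bound : ∀ {g : ℝ → ℝ} {D : ℝ}, (∀ x, |g x| ≤ D) → ∀ x, |g x ^ 2| ≤ D ^ 2 :=
    fun {g D} hD x => by
      rw [abs_pow]
      exact pow_le_pow_left₀ (abs_nonneg _) (hD x) 2
  have hvi := integrable_of_bounded hv hC
  have hfi := integrable_of_bounded hf hfC
  have hv2 := integrable_of_bounded (hv.pow 2) (sq_bound hC)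
  have hf2 := integrable_of_bounded (hf.pow 2) (sq_bound hfC)
  have expand : ∀ {g : ℝ → ℝ} (c : ℝ), Integrable g μ → Integrable (fun x => g x ^ 2) μ →
      Integrable (fun x => (g x - c) ^ 2) μ ∧
        ∫ x, (g x - c) ^ 2 ∂μ = varMu μ g + (∫ x, g x ∂μ - c) ^ 2 := fun {g} c h₁ h₂ => by
    have e : (fun x => (g x - c) ^ 2) = fun x => (g x ^ 2 - 2 * c * g x) + c ^ 2 := by
      funext x; ring
    have h₃ : Integrable (fun x => g x ^ 2 - 2 * c * g x) μ := h₂.sub (h₁.const_mul (2 * c))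
    refine ⟨?_, ?_⟩
    · rw [e]
      exact h₃.add (integrable_const _)
    · rw [e, integral_add h₃ (integrable_const _), integral_sub h₂ (h₁.const_mul _),
        integral_const_mul]
      simp only [varMu, integral_const, probReal_univ, one_smul]
      ring
  obtain ⟨x₀, hx₀⟩ : ∃ x₀, v x₀ = ∫ x, v x ∂μ :=
    mem_range_of_exists_le_of_exists_ge hv (exists_le_integral hvi) (exists_integral_le hvi)
  obtain ⟨hif, ef⟩ := expand (f x₀) hfi hf2
  obtain ⟨hiv, ev⟩ := expand (v x₀) hvi hv2
  have hmono : ∫ x, (f x - f x₀) ^ 2 ∂μ ≤ ∫ x, (v x - v x₀) ^ 2 ∂μ :=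
    integral_mono hif hiv fun x => sq_le_sq.mpr (h x x₀)
  rw [ef, ev, hx₀, sub_self] at hmono
  nlinarith [sq_nonneg (∫ x, f x ∂μ - f x₀)]

/-- The derivative of the total variation function of a `C¹` function. -/
lemma hasDerivAt_integral_abs_deriv {f : ℝ → ℝ} (hf : ContDiff ℝ 1 f) (x : ℝ) :
    HasDerivAt (fun x => ∫ t in (0:ℝ)..x, |deriv f t|) |deriv f x| x :=
  (hf.continuous_deriv le_rfl).abs.integral_hasStrictDerivAt 0 x |>.hasDerivAt

lemma deriv_integral_abs_deriv {f : ℝ → ℝ} (hf : ContDiff ℝ 1 f) :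
    deriv (fun x => ∫ t in (0:ℝ)..x, |deriv f t|) = fun x => |deriv f x| :=
  funext fun x => (hasDerivAt_integral_abs_deriv hf x).deriv

lemma contDiff_integral_abs_deriv {f : ℝ → ℝ} (hf : ContDiff ℝ 1 f) :
    ContDiff ℝ 1 (fun x => ∫ t in (0:ℝ)..x, |deriv f t|) := by
  rw [contDiff_one_iff_deriv, deriv_integral_abs_deriv hf]
  exact ⟨fun x => (hasDerivAt_integral_abs_deriv hf x).differentiableAt,
    (hf.continuous_deriv le_rfl).abs⟩

/-- The variance of a `C¹` function with compactly supported derivative is at most that of its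
total variation function. -/
lemma varMu_le_varMu_integral_abs_deriv {μ : Measure ℝ} [IsProbabilityMeasure μ] {f : ℝ → ℝ}
    (hf : ContDiff ℝ 1 f) (hs : HasCompactSupport (deriv f)) :
    varMu μ f ≤ varMu μ (fun x => ∫ t in (0:ℝ)..x, |deriv f t|) := by
  have hc : Continuous (deriv f) := hf.continuous_deriv le_rfl
  have hi : Integrable (fun t => |deriv f t|) := (hc.integrable_of_hasCompactSupport hs).abs
  refine varMu_le_varMu_of_abs_sub_le hf.continuous (contDiff_integral_abs_deriv hf).continuous
    (C := ∫ t, |deriv f t|) (fun x => ?_) (fun x y => ?_)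
  · have h₁ := intervalIntegral.norm_integral_le_integral_norm_uIoc
      (f := fun t => |deriv f t|) (a := 0) (b := x) (μ := volume)
    simp only [Real.norm_eq_abs, abs_abs] at h₁
    exact h₁.trans (setIntegral_le_integral hi (Filter.Eventually.of_forall fun t => abs_nonneg _))
  · rw [intervalIntegral.integral_interval_sub_left (hc.abs.intervalIntegrable _ _)
      (hc.abs.intervalIntegrable _ _), ← intervalIntegral.integral_deriv_eq_sub
      (fun t _ => (hf.differentiable one_ne_zero) t) (hc.intervalIntegrable _ _)]
    exact intervalIntegral.norm_integral_le_abs_integral_norm (f := deriv f)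

/-- Reduction to monotone functions for the spectral gap: the variance of `f` is bounded
by the variance of its total-variation function `v_f(x) = ∫_0^x |f'|`, and consequently
the infimum defining the spectral gap is unchanged when restricted to monotone
functions. -/
theorem spectral_gap_monotone_reduction
    (σ b : ℝ → ℝ) (U0 ρ : ℝ)
    (hσ : ContDiff ℝ (⊤ : ℕ∞) σ) (hb : ContDiff ℝ (⊤ : ℕ∞) b)
    (hσpos : ∀ x, 0 < σ x)
    (hcomp₁ : ∫⁻ u in Set.Ioi (0:ℝ), ENNReal.ofReal (1 / σ u) = ⊤)
    (hcomp₂ : ∫⁻ u in Set.Iio (0:ℝ), ENNReal.ofReal (1 / σ u) = ⊤)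
    (hVσ : ∀ x, ρ ≤ potV σ b σ x)
    (hprob : IsProbabilityMeasure (muMeas σ b U0)) :
    (∀ f : ℝ → ℝ, ContDiff ℝ (⊤ : ℕ∞) f → HasCompactSupport f →
      varMu (muMeas σ b U0) f
        ≤ varMu (muMeas σ b U0) (fun x => ∫ t in (0:ℝ)..x, |deriv f t|))
    ∧ sInf {r : ℝ | ∃ f : ℝ → ℝ, ContDiff ℝ 1 f ∧ HasCompactSupport (deriv f) ∧
          0 < varMu (muMeas σ b U0) f ∧
          r = (∫ x, σ x ^ 2 * deriv f x ^ 2 ∂(muMeas σ b U0)) / varMu (muMeas σ b U0) f}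
      = sInf {r : ℝ | ∃ f : ℝ → ℝ, ContDiff ℝ 1 f ∧ HasCompactSupport (deriv f) ∧
          Monotone f ∧ 0 < varMu (muMeas σ b U0) f ∧
          r = (∫ x, σ x ^ 2 * deriv f x ^ 2 ∂(muMeas σ b U0)) /
            varMu (muMeas σ b U0) f} := by
  refine ⟨fun f hf hs => varMu_le_varMu_integral_abs_deriv (hf.of_le (by exact_mod_cast le_top))
    hs.deriv, ?_⟩
  set μ := muMeas σ b U0
  set A : Set ℝ := {r : ℝ | ∃ f : ℝ → ℝ, ContDiff ℝ 1 f ∧ HasCompactSupport (deriv f) ∧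
    0 < varMu μ f ∧ r = (∫ x, σ x ^ 2 * deriv f x ^ 2 ∂μ) / varMu μ f}
  set B : Set ℝ := {r : ℝ | ∃ f : ℝ → ℝ, ContDiff ℝ 1 f ∧ HasCompactSupport (deriv f) ∧
    Monotone f ∧ 0 < varMu μ f ∧ r = (∫ x, σ x ^ 2 * deriv f x ^ 2 ∂μ) / varMu μ f}
  have hBA : B ⊆ A := fun r ⟨f, hf, hs, _, hv, hr⟩ => ⟨f, hf, hs, hv, hr⟩
  have energy_nonneg : ∀ f : ℝ → ℝ, 0 ≤ ∫ x, σ x ^ 2 * deriv f x ^ 2 ∂μ := fun f =>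
    integral_nonneg fun x => by positivity
  have hbdd : BddBelow A := ⟨0, by
    rintro r ⟨f, -, -, hv, rfl⟩
    exact div_nonneg (energy_nonneg f) hv.le⟩
  have hAB : ∀ r ∈ A, ∃ s ∈ B, s ≤ r := by
    rintro r ⟨f, hf, hs, hv, rfl⟩
    have hle := varMu_le_varMu_integral_abs_deriv (μ := μ) hf hs
    have hd := deriv_integral_abs_deriv hf
    refine ⟨_, ⟨fun x => ∫ t in (0:ℝ)..x, |deriv f t|, contDiff_integral_abs_deriv hf, ?_, ?_,
      hv.trans_le hle, rfl⟩, ?_⟩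
    · rw [hd]
      exact hs.comp_left abs_zero
    · refine monotone_of_deriv_nonneg
        ((contDiff_integral_abs_deriv hf).differentiable one_ne_zero) fun x => ?_
      rw [hd]
      exact abs_nonneg _
    · simp only [hd, sq_abs]
      exact div_le_div_of_nonneg_left (energy_nonneg f) hv hle
  rcases A.eq_empty_or_nonempty with hE | hne
  · rw [hE, Set.subset_empty_iff.mp (hBA.trans hE.subset)]
  · have hneB : B.Nonempty := by
      obtain ⟨r, hr⟩ := hne
      obtain ⟨s, hs, -⟩ := hAB r hr
      exact ⟨s, hs⟩
    refine le_antisymm (csInf_le_csInf hbdd hneB hBA) (le_csInf hne fun r hr => ?_)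
    obtain ⟨s, hs, hsr⟩ := hAB r hr
    exact csInf_le_of_le (hbdd.mono hBA) hs hsr
end

section
/- (Neumann–Dirichlet intertwining for Brownian motion on [0,1].) Let q_t(x,y) := (4πt)^{−1/2} e^{−(x−y)²/(4t)} be the heat kernel on ℝ, and for x, y ∈ [0,1] define the Neumann kernel p_t(x,y) := Σ_{k∈ℤ} ( q_t(x, y+2k) + q_t(x, −y+2k) ) and the Dirichlet kernel p̃_t(x,y) := Σ_{k∈ℤ} ( q_t(x, y+2k) − q_t(x, −y+2k) ). Then for every t > 0, every continuously differentiable f : [0,1] → ℝ and every x ∈ [0,1]: d/dx ∫_0^1 p_t(x,y) f(y) dy = ∫_0^1 p̃_t(x,y) f'(y) dy. Moreover, since 0 ≤ p̃_t ≤ p_t, it follows that | d/dx ∫_0^1 p_t(x,y) f(y) dy | ≤ ∫_0^1 p_t(x,y) |f'(y)| dy. -/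
open MeasureTheory Real

/-- The Gaussian heat kernel (speed 2) on `ℝ`: `q_t(x,y) = e^{−(x−y)²/(4t)}/√(4πt)`. -/
noncomputable def qker (t x y : ℝ) : ℝ :=
  (Real.sqrt (4 * Real.pi * t))⁻¹ * Real.exp (-(x - y) ^ 2 / (4 * t))

/-- The Neumann heat kernel on `[0,1]`, obtained by even reflections. -/
noncomputable def pNeu (t x y : ℝ) : ℝ :=
  ∑' k : ℤ, (qker t x (y + 2 * (k : ℝ)) + qker t x (-y + 2 * (k : ℝ)))

/-- The Dirichlet heat kernel on `[0,1]`, obtained by odd reflections. -/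
noncomputable def pDir (t x y : ℝ) : ℝ :=
  ∑' k : ℤ, (qker t x (y + 2 * (k : ℝ)) - qker t x (-y + 2 * (k : ℝ)))

/-- The heat kernel on the circle `ℝ / 2ℤ`, lifted to `ℝ`. -/
noncomputable def circleHeatKernel (t z : ℝ) : ℝ :=
  ∑' k : ℤ, qker t z (2 * (k : ℝ))

lemma qker_nonneg (t x y : ℝ) : 0 ≤ qker t x y := by
  unfold qker
  positivity

/-- The Gaussian centred at `2k` is a Gaussian prefactor times a term of the Jacobi theta series. -/
lemma ofReal_qker_eq_jacobiTheta₂_term {t : ℝ} (ht : 0 < t) (z : ℝ) (k : ℤ) :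
    ((qker t z (2 * (k : ℝ)) : ℝ) : ℂ) =
      (((Real.sqrt (4 * Real.pi * t))⁻¹ : ℝ) : ℂ) * Complex.exp (-(z : ℂ) ^ 2 / (4 * t)) *
        jacobiTheta₂_term k (z / (2 * π * Complex.I * t)) (Complex.I / (π * t)) := by
  have htc : (t : ℂ) ≠ 0 := by exact_mod_cast ht.ne'
  have hpi : (π : ℂ) ≠ 0 := by exact_mod_cast Real.pi_ne_zero
  have hI := Complex.I_ne_zero
  rw [qker, jacobiTheta₂_term, mul_assoc _ (Complex.exp _), ← Complex.exp_add]
  push_cast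
  congr 2
  field_simp
  rw [Complex.I_sq]
  ring

lemma im_I_div_pi_mul_pos {t : ℝ} (ht : 0 < t) : 0 < (Complex.I / (π * t)).im := by
  rw [← Complex.ofReal_mul, Complex.div_ofReal_im, Complex.I_im]
  positivity

lemma hasSum_ofReal_qker {t : ℝ} (ht : 0 < t) (z : ℝ) :
    HasSum (fun k : ℤ => ((qker t z (2 * (k : ℝ)) : ℝ) : ℂ))
      ((((Real.sqrt (4 * Real.pi * t))⁻¹ : ℝ) : ℂ) * Complex.exp (-(z : ℂ) ^ 2 / (4 * t)) *
        jacobiTheta₂ (z / (2 * π * Complex.I * t)) (Complex.I / (π * t))) := by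
  simp_rw [ofReal_qker_eq_jacobiTheta₂_term ht]
  exact (hasSum_jacobiTheta₂_term _ (im_I_div_pi_mul_pos ht)).mul_left _

lemma summable_qker {t : ℝ} (ht : 0 < t) (z : ℝ) :
    Summable (fun k : ℤ => qker t z (2 * (k : ℝ))) :=
  Complex.summable_ofReal.1 (hasSum_ofReal_qker ht z).summable

lemma contDiff_circleHeatKernel {t : ℝ} (ht : 0 < t) {n : WithTop ℕ∞} :
    ContDiff ℝ n (circleHeatKernel t) := by
  let G : ℂ → ℂ := fun z =>
    (((Real.sqrt (4 * Real.pi * t))⁻¹ : ℝ) : ℂ) * Complex.exp (-z ^ 2 / (4 * t)) *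
      jacobiTheta₂ (z / (2 * π * Complex.I * t)) (Complex.I / (π * t))
  have hG : Differentiable ℂ G := by
    have hθ : Differentiable ℂ (fun z => jacobiTheta₂ z (Complex.I / (π * t))) := fun z =>
      differentiableAt_jacobiTheta₂_fst z (im_I_div_pi_mul_pos ht)
    have hθ' : Differentiable ℂ
        (fun z => jacobiTheta₂ (z / (2 * π * Complex.I * t)) (Complex.I / (π * t))) :=
      hθ.comp (differentiable_id.div_const _)
    exact Differentiable.mul (by fun_prop) hθ'
  have hre : circleHeatKernel t = fun z : ℝ => (G z).re := by
    ext z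
    have h := (hasSum_ofReal_qker ht z).tsum_eq
    rw [← Complex.ofReal_tsum] at h
    exact congrArg Complex.re h
  rw [hre]
  exact Complex.reCLM.contDiff.comp
    ((hG.contDiff.restrict_scalars ℝ).comp Complex.ofRealCLM.contDiff)

lemma circleHeatKernel_add_two (t z : ℝ) :
    circleHeatKernel t (z + 2) = circleHeatKernel t z := by
  unfold circleHeatKernel
  rw [← (Equiv.addRight (1 : ℤ)).tsum_eq]
  refine tsum_congr fun k => ?_
  simp only [qker, Equiv.coe_addRight]
  push_cast
  ring_nf

lemma qker_add (t x y c : ℝ) : qker t x (y + c) = qker t (x - y) c := by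
  simp only [qker]
  ring_nf

lemma pNeu_eq {t : ℝ} (ht : 0 < t) (x y : ℝ) :
    pNeu t x y = circleHeatKernel t (x - y) + circleHeatKernel t (x + y) := by
  simp only [pNeu, qker_add, sub_neg_eq_add]
  exact (summable_qker ht _).tsum_add (summable_qker ht _)

lemma pDir_eq {t : ℝ} (ht : 0 < t) (x y : ℝ) :
    pDir t x y = circleHeatKernel t (x - y) - circleHeatKernel t (x + y) := by
  simp only [pDir, qker_add, sub_neg_eq_add]
  exact (summable_qker ht _).tsum_sub (summable_qker ht _)

lemma circleHeatKernel_nonneg (t z : ℝ) : 0 ≤ circleHeatKernel t z :=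
  tsum_nonneg fun _ => qker_nonneg _ _ _

lemma abs_pDir_le_pNeu {t : ℝ} (ht : 0 < t) (x y : ℝ) : |pDir t x y| ≤ pNeu t x y := by
  have h₁ := circleHeatKernel_nonneg t (x - y)
  have h₂ := circleHeatKernel_nonneg t (x + y)
  rw [pDir_eq ht, pNeu_eq ht, abs_le]
  constructor <;> linarith

/-- Differentiation under the integral sign for a kernel with jointly continuous derivative. -/
lemma hasDerivAt_intervalIntegral_mul_of_continuous {K K' : ℝ → ℝ → ℝ} {f : ℝ → ℝ} {a b : ℝ}
    (hab : a ≤ b) (hK : ∀ x, Continuous (K x)) (hK' : Continuous fun p : ℝ × ℝ => K' p.1 p.2)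
    (hKK' : ∀ x y, HasDerivAt (fun x' => K x' y) (K' x y) x)
    (hf : ContinuousOn f (Set.Icc a b)) (x : ℝ) :
    HasDerivAt (fun x' => ∫ y in a..b, K x' y * f y) (∫ y in a..b, K' x y * f y) x := by
  have huIcc : Set.uIcc a b = Set.Icc a b := Set.uIcc_of_le hab
  have hmeas : ∀ {g : ℝ → ℝ}, Continuous g →
      IntervalIntegrable (fun y => g y * f y) volume a b := fun hg =>
    ContinuousOn.intervalIntegrable (by rw [huIcc]; exact hg.continuousOn.mul hf)
  have hcomp : IsCompact (Set.Icc (x - 1) (x + 1) ×ˢ Set.Icc a b) :=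
    isCompact_Icc.prod isCompact_Icc
  obtain ⟨C, hC⟩ := hcomp.exists_bound_of_continuousOn
    (f := fun p : ℝ × ℝ => K' p.1 p.2 * f p.2)
    (hK'.continuousOn.mul (hf.comp continuous_snd.continuousOn fun p hp => hp.2))
  refine (intervalIntegral.hasDerivAt_integral_of_dominated_loc_of_deriv_le
    (F := fun x' y => K x' y * f y) (F' := fun x' y => K' x' y * f y)
    (bound := fun _ => C) (Icc_mem_nhds (sub_one_lt x) (lt_add_one x))
    (Filter.Eventually.of_forall fun x' => ?_) (hmeas (hK x)) ?_ ?_ (by simp) ?_).2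
  · exact (intervalIntegrable_iff.1 (hmeas (hK x'))).aestronglyMeasurable
  · exact (intervalIntegrable_iff.1
      (hmeas (g := K' x) (by fun_prop))).aestronglyMeasurable
  · refine Filter.Eventually.of_forall fun y hy x' hx' => hC (x', y) ⟨hx', ?_⟩
    rw [← huIcc]
    exact Set.uIoc_subset_uIcc hy
  · exact Filter.Eventually.of_forall fun y _ x' _ => (hKK' x' y).mul_const _

lemma hasDerivAt_integral_pNeu_mul {t : ℝ} (ht : 0 < t) {f : ℝ → ℝ}
    (hf : ContDiffOn ℝ 1 f (Set.Icc 0 1)) (x : ℝ) :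
    HasDerivAt (fun x' => ∫ y in (0:ℝ)..1, pNeu t x' y * f y)
      (∫ y in (0:ℝ)..1, pDir t x y * derivWithin f (Set.Icc 0 1) y) x := by
  have hθ : ContDiff ℝ 1 (circleHeatKernel t) := contDiff_circleHeatKernel ht
  have hθc : Continuous (circleHeatKernel t) := hθ.continuous
  have hθ'c : Continuous (deriv (circleHeatKernel t)) := hθ.continuous_deriv le_rfl
  have hθd : ∀ z, HasDerivAt (circleHeatKernel t) (deriv (circleHeatKernel t) z) z := fun z =>
    (hθ.differentiable one_ne_zero z).hasDerivAt
  have hf'c : ContinuousOn (derivWithin f (Set.Icc 0 1)) (Set.Icc 0 1) :=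
    hf.continuousOn_derivWithin (uniqueDiffOn_Icc one_pos) le_rfl
  have hfd : ∀ y ∈ Set.Ioo (0:ℝ) 1, HasDerivAt f (derivWithin f (Set.Icc 0 1) y) y := fun y hy =>
    ((hf.differentiableOn one_ne_zero y (Set.Ioo_subset_Icc_self hy)).hasDerivWithinAt).hasDerivAt
      (Icc_mem_nhds hy.1 hy.2)
  have hderiv := hasDerivAt_intervalIntegral_mul_of_continuous (a := 0) (b := 1)
    (K := fun x y => circleHeatKernel t (x - y) + circleHeatKernel t (x + y))
    (K' := fun x y => deriv (circleHeatKernel t) (x - y) + deriv (circleHeatKernel t) (x + y))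
    zero_le_one (fun x => by fun_prop) (by fun_prop)
    (fun x y => ((hθd _).comp_sub_const x y).add ((hθd _).comp_add_const x y))
    hf.continuousOn x
  have hparts := intervalIntegral.integral_mul_deriv_eq_deriv_mul_of_hasDerivAt
    (a := 0) (b := 1) (u := f) (u' := derivWithin f (Set.Icc 0 1))
    (v := fun y => circleHeatKernel t (x + y) - circleHeatKernel t (x - y))
    (v' := fun y => deriv (circleHeatKernel t) (x - y) + deriv (circleHeatKernel t) (x + y))
    (by simpa using hf.continuousOn) (by fun_prop) (by simpa using hfd)
    (fun y _ => by
      refine (((hθd _).comp_const_add x y).sub ((hθd _).comp_const_sub x y)).congr_deriv ?_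
      ring)
    (ContinuousOn.intervalIntegrable (by simpa using hf'c))
    (Continuous.intervalIntegrable (by fun_prop) _ _)
  have hperiod : circleHeatKernel t (x + 1) = circleHeatKernel t (x - 1) := by
    rw [← circleHeatKernel_add_two t (x - 1)]
    ring_nf
  simp only [pNeu_eq ht, pDir_eq ht]
  convert hderiv using 1
  simp only [mul_comm _ (f _)]
  rw [hparts, hperiod, add_zero, sub_zero, sub_self, sub_self, mul_zero, mul_zero, sub_zero,
    zero_sub, ← intervalIntegral.integral_neg]
  refine intervalIntegral.integral_congr fun y _ => ?_
  ring

/-- Intertwining between the Neumann and Dirichlet heat semigroups on `[0,1]`: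
`(P_t f)' = P̃_t (f')`, and consequently `|(P_t f)'| ≤ P_t(|f'|)`. -/
theorem neumann_dirichlet_intertwining :
    ∀ t : ℝ, 0 < t →
    ∀ f : ℝ → ℝ, ContDiffOn ℝ 1 f (Set.Icc 0 1) →
    ∀ x ∈ Set.Icc (0:ℝ) 1,
      HasDerivAt (fun x' => ∫ y in (0:ℝ)..1, pNeu t x' y * f y)
        (∫ y in (0:ℝ)..1, pDir t x y * derivWithin f (Set.Icc 0 1) y) x
      ∧ |deriv (fun x' => ∫ y in (0:ℝ)..1, pNeu t x' y * f y) x|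
          ≤ ∫ y in (0:ℝ)..1, pNeu t x y * |derivWithin f (Set.Icc 0 1) y| := by
  intro t ht f hf x _
  have hderiv := hasDerivAt_integral_pNeu_mul ht hf x
  refine ⟨hderiv, ?_⟩
  have hθc : Continuous (circleHeatKernel t) :=
    (contDiff_circleHeatKernel ht (n := 0)).continuous
  have hf'c : ContinuousOn (derivWithin f (Set.Icc 0 1)) (Set.uIcc 0 1) := by
    simpa using hf.continuousOn_derivWithin (uniqueDiffOn_Icc one_pos) le_rfl
  have hNeu : Continuous (pNeu t x) := by
    simp only [funext (pNeu_eq ht x)]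
    fun_prop
  have hDir : Continuous (pDir t x) := by
    simp only [funext (pDir_eq ht x)]
    fun_prop
  rw [hderiv.deriv]
  refine (intervalIntegral.abs_integral_le_integral_abs zero_le_one).trans ?_
  refine intervalIntegral.integral_mono_on zero_le_one
    (hDir.continuousOn.mul hf'c).abs.intervalIntegrable
    (hNeu.continuousOn.mul hf'c.abs).intervalIntegrable fun y _ => ?_
  rw [abs_mul]
  exact mul_le_mul_of_nonneg_right (abs_pDir_le_pNeu ht x y) (abs_nonneg _)
end

section
/- For every α > 1 and every x ≥ 0, (∫_x^{+∞} e^{−y^α/α} dy) · (∫_0^x e^{y^α/α} dy) ≤ α^{2/α} Γ(1 + 1/α)², where Γ is the Gamma function. Consequently, by Muckenhoupt's criterion, the spectral gap of the probability measure μ_α with density proportional to e^{−|x|^α/α} satisfies λ₁ ≥ 1/(4 α^{2/α} Γ(1 + 1/α)²), i.e. Var_{μ_α}(f) ≤ 4 α^{2/α} Γ(1+1/α)² ∫ f'² dμ_α for all smooth compactly supported f. -/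
open MeasureTheory

/-- Normalization constant `Z_α = ∫ e^{−|x|^α/α} dx`. -/
noncomputable def Zalpha (α : ℝ) : ℝ := ∫ x : ℝ, Real.exp (-(|x| ^ α) / α)

/-- The probability measure `μ_α` with density `e^{−|x|^α/α}/Z_α`. -/
noncomputable def muAlpha (α : ℝ) : Measure ℝ :=
  volume.withDensity (fun x => ENNReal.ofReal (Real.exp (-(|x| ^ α) / α) / Zalpha α))

section

open Set Filter Topology

/-- Weighted Hardy inequality on `[0, R]`, under a pointwise form of Muckenhoupt's condition. -/
theorem hardy_of_mul_integral_inv_le {w g : ℝ → ℝ} {c : ℝ} (hw : Continuous w)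
    (hw0 : ∀ x, 0 < w x) (hc : ∀ x, 0 ≤ x → w x * ∫ y in (0:ℝ)..x, (w y)⁻¹ ≤ c)
    (hg : ContDiff ℝ 1 g) (hg0 : g 0 = 0) {R : ℝ} (hR : 0 ≤ R) :
    ∫ x in (0:ℝ)..R, w x * g x ^ 2 ≤ 4 * c ^ 2 * ∫ x in (0:ℝ)..R, w x * deriv g x ^ 2 := by
  have hwi : Continuous fun y => (w y)⁻¹ := hw.inv₀ fun x => (hw0 x).ne'
  have hgc := hg.continuous
  have hg' : Continuous (deriv g) := hg.continuous_deriv le_rfl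
  have hgd : ∀ x, HasDerivAt g (deriv g x) x := fun x =>
    (hg.differentiable one_ne_zero x).hasDerivAt
  set G : ℝ → ℝ := fun x => ∫ y in (0:ℝ)..x, (w y)⁻¹ with hG
  have hGd : ∀ x, HasDerivAt G (w x)⁻¹ x := fun x =>
    intervalIntegral.integral_hasDerivAt_right (hwi.intervalIntegrable _ _)
      (hwi.stronglyMeasurableAtFilter _ _) hwi.continuousAt
  have hG0 : G 0 = 0 := by simp [hG]
  have hGpos : ∀ x, 0 < x → 0 < G x := fun x hx =>
    intervalIntegral.intervalIntegral_pos_of_pos (hwi.intervalIntegrable _ _)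
      (fun y => inv_pos.2 (hw0 y)) hx
  have h1 : Continuous fun x => w x * deriv g x ^ 2 := by fun_prop
  have h2 : Continuous fun x => w x * g x ^ 2 := by fun_prop
  have hA : ∀ x, HasDerivAt (fun x => ∫ y in (0:ℝ)..x, w y * deriv g y ^ 2)
      (w x * deriv g x ^ 2) x := fun x =>
    intervalIntegral.integral_hasDerivAt_right (h1.intervalIntegrable _ _)
      (h1.stronglyMeasurableAtFilter _ _) h1.continuousAt
  have hB : ∀ x, HasDerivAt (fun x => ∫ y in (0:ℝ)..x, w y * g y ^ 2)
      (w x * g x ^ 2) x := fun x =>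
    intervalIntegral.integral_hasDerivAt_right (h2.intervalIntegrable _ _)
      (h2.stronglyMeasurableAtFilter _ _) h2.continuousAt
  have hQ : ∀ x, 0 < x → HasDerivAt (fun x => g x ^ 2 / (2 * G x))
      (g x * deriv g x / G x - g x ^ 2 / (2 * w x * G x ^ 2)) x := by
    intro x hx
    have h := ((hgd x).pow 2).div ((hGd x).const_mul 2) (mul_pos two_pos (hGpos x hx)).ne'
    refine h.congr_deriv ?_
    have := (hGpos x hx).ne'
    have := (hw0 x).ne'
    simp
    field_simp
  have hQ0 : Tendsto (fun x => g x ^ 2 / (2 * G x)) (𝓝[≠] 0) (𝓝 0) := by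
    have e1 := hasDerivAt_iff_tendsto_slope.1 (hgd 0)
    have e2 := hasDerivAt_iff_tendsto_slope.1 (hGd 0)
    have e3 : Tendsto g (𝓝[≠] 0) (𝓝 0) := by
      simpa [hg0] using (hgc.tendsto 0).mono_left nhdsWithin_le_nhds
    have e4 := (e1.mul e3).div (e2.const_mul 2) (by have := hw0 0; positivity)
    rw [mul_zero, zero_div] at e4
    refine e4.congr' ?_
    filter_upwards [self_mem_nhdsWithin] with x hx
    have hx : x ≠ 0 := hx
    simp only [slope, hg0, hG0, vsub_eq_sub, sub_zero, smul_eq_mul, Pi.div_apply]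
    rw [show x⁻¹ * g x * g x = x⁻¹ * g x ^ 2 by ring,
      show 2 * (x⁻¹ * G x) = x⁻¹ * (2 * G x) by ring,
      mul_div_mul_left _ _ (inv_ne_zero hx)]
  have hQc : ContinuousOn (fun x => g x ^ 2 / (2 * G x)) (Ici 0) := by
    intro x hx
    rcases eq_or_lt_of_le (show (0:ℝ) ≤ x from hx) with rfl | hx
    · have : ContinuousAt (fun x => g x ^ 2 / (2 * G x)) 0 := by
        rw [continuousAt_iff_punctured_nhds]
        simpa [hg0] using hQ0
      exact this.continuousWithinAt
    · exact (hQ x hx).continuousAt.continuousWithinAt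
  set Φ : ℝ → ℝ := fun x => 4 * c ^ 2 * ((∫ y in (0:ℝ)..x, w y * deriv g y ^ 2)
    - g x ^ 2 / (2 * G x)) - ∫ y in (0:ℝ)..x, w y * g y ^ 2 with hΦ
  have hΦd : ∀ x, 0 < x → HasDerivAt Φ (4 * c ^ 2 * (w x * deriv g x ^ 2
      - (g x * deriv g x / G x - g x ^ 2 / (2 * w x * G x ^ 2))) - w x * g x ^ 2) x :=
    fun x hx => (((hA x).sub (hQ x hx)).const_mul _).sub (hB x)
  have hmono : MonotoneOn Φ (Ici 0) := by
    refine monotoneOn_of_deriv_nonneg (convex_Ici 0) ?_ ?_ ?_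
    · exact (((continuous_iff_continuousAt.2 fun x => (hA x).continuousAt).continuousOn.sub
        hQc).const_mul _).sub
        (continuous_iff_continuousAt.2 fun x => (hB x).continuousAt).continuousOn
    · rw [interior_Ici]
      exact fun x hx => (hΦd x hx).differentiableAt.differentiableWithinAt
    · rw [interior_Ici]
      intro x hx
      rw [(hΦd x hx).deriv]
      have hw' := hw0 x
      have hG' := hGpos x hx
      have hcx : w x * G x ≤ c := hc x (le_of_lt hx)
      have hsq : (w x * G x) ^ 2 ≤ c ^ 2 := by gcongr
      have hcore : g x ^ 2 / (4 * w x * G x ^ 2) ≤ w x * deriv g x ^ 2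
          - (g x * deriv g x / G x - g x ^ 2 / (2 * w x * G x ^ 2)) := by
        have : w x * deriv g x ^ 2 - (g x * deriv g x / G x - g x ^ 2 / (2 * w x * G x ^ 2))
            - g x ^ 2 / (4 * w x * G x ^ 2) = w x * (deriv g x - g x / (2 * w x * G x)) ^ 2 := by
          field_simp
          ring
        have h3 : 0 ≤ w x * (deriv g x - g x / (2 * w x * G x)) ^ 2 := by positivity
        linarith
      have hlow : w x * g x ^ 2 ≤ 4 * c ^ 2 * (g x ^ 2 / (4 * w x * G x ^ 2)) := by
        have : w x * g x ^ 2 = 4 * (w x * G x) ^ 2 * (g x ^ 2 / (4 * w x * G x ^ 2)) := by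
          field_simp
        rw [this]
        gcongr
      have := mul_le_mul_of_nonneg_left hcore (show 0 ≤ 4 * c ^ 2 by positivity)
      linarith
  have h := hmono (mem_Ici.2 le_rfl) (mem_Ici.2 hR) hR
  have hQR : 0 ≤ 4 * c ^ 2 * (g R ^ 2 / (2 * G R)) := by
    have : 0 ≤ G R := by
      rcases hR.eq_or_lt with rfl | hR
      · exact hG0.ge
      · exact (hGpos R hR).le
    positivity
  simp only [hΦ, intervalIntegral.integral_same, hg0] at h
  simp only [mul_sub] at h
  norm_num at h
  linarith

/-- The weighted Hardy inequality on `ℝ` for an even weight. -/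
theorem integral_sub_sq_le_of_even {w f : ℝ → ℝ} {c : ℝ} (hw : Continuous w)
    (hw0 : ∀ x, 0 < w x) (heven : ∀ x, w (-x) = w x) (hwint : Integrable w)
    (hc : ∀ x, 0 ≤ x → w x * ∫ y in (0:ℝ)..x, (w y)⁻¹ ≤ c)
    (hf : ContDiff ℝ 1 f) (hcs : HasCompactSupport f) :
    ∫ x, w x * (f x - f 0) ^ 2 ≤ 4 * c ^ 2 * ∫ x, w x * deriv f x ^ 2 := by
  have hfc := hf.continuous
  have hf' : Continuous (deriv f) := hf.continuous_deriv le_rfl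
  have hbdd : ∀ h : ℝ → ℝ, Continuous h → (∃ C, ∀ x, ‖h x‖ ≤ C) →
      Integrable fun x => w x * h x := fun h hh ⟨C, hC⟩ =>
    hwint.mul_bdd hh.aestronglyMeasurable (ae_of_all _ hC)
  obtain ⟨C, hC⟩ := hcs.exists_bound_of_continuous hfc
  obtain ⟨D, hD⟩ := hcs.deriv.exists_bound_of_continuous hf'
  have i1 : Integrable fun x => w x * (f x - f 0) ^ 2 := by
    refine hbdd _ (by fun_prop) ⟨(C + C) ^ 2, fun x => ?_⟩
    rw [norm_pow]
    gcongr
    exact (norm_sub_le _ _).trans (add_le_add (hC x) (hC 0))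
  have i2 : Integrable fun x => w x * deriv f x ^ 2 := by
    refine hbdd _ (by fun_prop) ⟨D ^ 2, fun x => ?_⟩
    rw [norm_pow]
    gcongr
    exact hD x
  have t1 := intervalIntegral_tendsto_integral i1 tendsto_neg_atTop_atBot tendsto_id
  have t2 := (intervalIntegral_tendsto_integral i2 tendsto_neg_atTop_atBot tendsto_id).const_mul
    (4 * c ^ 2)
  refine le_of_tendsto_of_tendsto t1 t2 ?_
  filter_upwards [eventually_ge_atTop 0] with R hR
  have hdr : ∀ x, deriv (fun x => f x - f 0) x = deriv f x := fun x => by simp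
  have hdl : ∀ x, deriv (fun x => f (-x) - f 0) x = -deriv f (-x) := fun x => by
    simp [deriv_comp_neg]
  have hr := hardy_of_mul_integral_inv_le hw hw0 hc (g := fun x => f x - f 0)
    (hf.sub contDiff_const) (by simp) hR
  have hl := hardy_of_mul_integral_inv_le hw hw0 hc (g := fun x => f (-x) - f 0)
    ((hf.comp contDiff_neg).sub contDiff_const) (by simp) hR
  simp only [hdr] at hr
  simp only [hdl, neg_sq] at hl
  have n1 := intervalIntegral.integral_comp_neg (a := 0) (b := R)
    (fun x => w x * (f x - f 0) ^ 2)
  have n2 := intervalIntegral.integral_comp_neg (a := 0) (b := R)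
    (fun x => w x * deriv f x ^ 2)
  simp only [heven, neg_zero] at n1 n2
  rw [n1, n2] at hl
  rw [id, ← intervalIntegral.integral_add_adjacent_intervals (b := 0) i1.intervalIntegrable
      i1.intervalIntegrable,
    ← intervalIntegral.integral_add_adjacent_intervals (b := 0) i2.intervalIntegrable
      i2.intervalIntegrable]
  linarith

section Weight

variable {α : ℝ}

theorem continuous_exp_neg_abs_rpow (hα : 1 < α) :
    Continuous fun x : ℝ => Real.exp (-(|x| ^ α) / α) :=
  Real.continuous_exp.comp
    ((continuous_abs.rpow_const fun _ => Or.inr (by linarith)).neg.div_const α)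

theorem integral_Ioi_exp_neg_rpow (hα : 1 < α) :
    ∫ x in Ioi (0:ℝ), Real.exp (-(x ^ α) / α) = α ^ (1 / α) * Real.Gamma (1 + 1 / α) := by
  have h0 : 0 < α := by linarith
  have h := integral_exp_neg_mul_rpow h0 (inv_pos.2 h0)
  rw [Real.inv_rpow h0.le, neg_div, Real.rpow_neg h0.le, inv_inv, add_comm (1 / α)] at h
  rw [← h]
  congr 1 with x
  congr 1
  ring

theorem integral_Ioi_exp_neg_rpow_pos (hα : 1 < α) :
    0 < ∫ x in Ioi (0:ℝ), Real.exp (-(x ^ α) / α) := by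
  have h0 : 0 < α := by linarith
  rw [integral_Ioi_exp_neg_rpow hα]
  exact mul_pos (Real.rpow_pos_of_pos h0 _) (Real.Gamma_pos_of_pos (by positivity))

theorem integrableOn_exp_neg_rpow (hα : 1 < α) :
    IntegrableOn (fun x : ℝ => Real.exp (-(x ^ α) / α)) (Ioi 0) :=
  Integrable.of_integral_ne_zero (integral_Ioi_exp_neg_rpow_pos hα).ne'

theorem Zalpha_pos (hα : 1 < α) : 0 < Zalpha α := by
  rw [Zalpha, integral_comp_abs (f := fun x => Real.exp (-(x ^ α) / α))]
  exact mul_pos two_pos (integral_Ioi_exp_neg_rpow_pos hα)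

theorem integrable_exp_neg_abs_rpow (hα : 1 < α) :
    Integrable fun x : ℝ => Real.exp (-(|x| ^ α) / α) :=
  Integrable.of_integral_ne_zero (Zalpha_pos hα).ne'

theorem exp_neg_rpow_add_le (hα : 1 < α) {a b : ℝ} (ha : 0 ≤ a) (hb : 0 ≤ b) :
    Real.exp (-((a + b) ^ α) / α) ≤ Real.exp (-(a ^ α) / α) * Real.exp (-(b ^ α) / α) := by
  have h0 : 0 < α := by linarith
  rw [← Real.exp_add, ← add_div, Real.exp_le_exp, div_le_div_iff_of_pos_right h0]
  linarith [Real.add_rpow_le_rpow_add ha hb hα.le]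

theorem integral_Ioi_exp_neg_rpow_le (hα : 1 < α) {x : ℝ} (hx : 0 ≤ x) :
    ∫ y in Ioi x, Real.exp (-(y ^ α) / α)
      ≤ Real.exp (-(x ^ α) / α) * (α ^ (1 / α) * Real.Gamma (1 + 1 / α)) := by
  have hpre : (fun y => x + y) ⁻¹' Ioi x = Ioi 0 := by ext; simp
  have h := (measurePreserving_add_left volume x).setIntegral_preimage_emb
    (measurableEmbedding_addLeft x) (fun y => Real.exp (-(y ^ α) / α)) (Ioi x)
  have hi := (measurePreserving_add_left volume x).integrableOn_comp_preimage
    (measurableEmbedding_addLeft x) (f := fun y => Real.exp (-(y ^ α) / α)) (s := Ioi x)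
  rw [hpre] at h hi
  rw [← h, ← integral_Ioi_exp_neg_rpow hα, ← integral_const_mul]
  exact setIntegral_mono_on
    (hi.2 ((integrableOn_exp_neg_rpow hα).mono_set (Ioi_subset_Ioi hx)))
    ((integrableOn_exp_neg_rpow hα).const_mul _) measurableSet_Ioi
    fun y hy => exp_neg_rpow_add_le hα hx (le_of_lt hy)

theorem exp_neg_rpow_mul_integral_le (hα : 1 < α) {x : ℝ} (hx : 0 ≤ x) :
    Real.exp (-(x ^ α) / α) * ∫ y in (0:ℝ)..x, Real.exp (y ^ α / α)
      ≤ α ^ (1 / α) * Real.Gamma (1 + 1 / α) := by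
  have h0 : 0 < α := by linarith
  have hpow : Continuous fun y : ℝ => y ^ α := Real.continuous_rpow_const h0.le
  rw [← intervalIntegral.integral_const_mul]
  calc ∫ y in (0:ℝ)..x, Real.exp (-(x ^ α) / α) * Real.exp (y ^ α / α)
      ≤ ∫ y in (0:ℝ)..x, Real.exp (-((x - y) ^ α) / α) := by
        refine intervalIntegral.integral_mono_on hx
          (Continuous.intervalIntegrable (by fun_prop) _ _)
          (Continuous.intervalIntegrable ?_ _ _) fun y hy => ?_
        · exact Real.continuous_exp.comp
            ((hpow.comp (continuous_const.sub continuous_id)).neg.div_const α)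
        · rw [← Real.exp_add, ← add_div, Real.exp_le_exp, div_le_div_iff_of_pos_right h0]
          have := Real.add_rpow_le_rpow_add hy.1 (sub_nonneg.2 hy.2) hα.le
          rw [add_sub_cancel] at this
          linarith
    _ = ∫ y in (0:ℝ)..x, Real.exp (-(y ^ α) / α) := by
        rw [intervalIntegral.integral_comp_sub_left (fun y => Real.exp (-(y ^ α) / α))]
        simp
    _ ≤ α ^ (1 / α) * Real.Gamma (1 + 1 / α) := by
        rw [← integral_Ioi_exp_neg_rpow hα, intervalIntegral.integral_of_le hx]
        exact setIntegral_mono_set (integrableOn_exp_neg_rpow hα)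
          (ae_of_all _ fun y => (Real.exp_pos _).le) Ioc_subset_Ioi_self.eventuallyLE

theorem integral_muAlpha (hα : 1 < α) (h : ℝ → ℝ) :
    ∫ x, h x ∂(muAlpha α) = (∫ x, Real.exp (-(|x| ^ α) / α) * h x) / Zalpha α := by
  rw [muAlpha, integral_withDensity_eq_integral_toReal_smul
    ((continuous_exp_neg_abs_rpow hα).div_const _).measurable.ennreal_ofReal (by simp),
    ← integral_div]
  congr 1 with x
  rw [ENNReal.toReal_ofReal (div_nonneg (Real.exp_pos _).le (Zalpha_pos hα).le), smul_eq_mul]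
  ring

theorem varMu_muAlpha_le (hα : 1 < α) {f : ℝ → ℝ} (hf : Continuous f)
    (hcs : HasCompactSupport f) (a : ℝ) :
    varMu (muAlpha α) f ≤ ∫ x, (f x - a) ^ 2 ∂(muAlpha α) := by
  have hZ := Zalpha_pos hα
  have hw := integrable_exp_neg_abs_rpow hα
  obtain ⟨C, hC⟩ := hcs.exists_bound_of_continuous hf
  have i1 : Integrable fun x => Real.exp (-(|x| ^ α) / α) * f x :=
    hw.mul_bdd hf.aestronglyMeasurable (ae_of_all _ hC)
  have i2 : Integrable fun x => Real.exp (-(|x| ^ α) / α) * f x ^ 2 := by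
    refine hw.mul_bdd (c := C ^ 2) (hf.pow 2).aestronglyMeasurable (ae_of_all _ fun x => ?_)
    rw [norm_pow]
    gcongr
    exact hC x
  have i3 : Integrable fun x => Real.exp (-(|x| ^ α) / α) * f x ^ 2
      - 2 * a * (Real.exp (-(|x| ^ α) / α) * f x) := i2.sub (i1.const_mul _)
  have key : ∫ x, Real.exp (-(|x| ^ α) / α) * (f x - a) ^ 2
      = (∫ x, Real.exp (-(|x| ^ α) / α) * f x ^ 2)
        - 2 * a * (∫ x, Real.exp (-(|x| ^ α) / α) * f x) + a ^ 2 * Zalpha α := by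
    rw [Zalpha, ← integral_const_mul, ← integral_const_mul, ← integral_sub i2 (i1.const_mul _),
      ← integral_add i3 (hw.const_mul _)]
    congr 1 with x
    ring
  rw [varMu, integral_muAlpha hα, integral_muAlpha hα, integral_muAlpha hα, key, add_div, sub_div,
    mul_div_assoc, mul_div_cancel_right₀ _ hZ.ne']
  nlinarith [sq_nonneg ((∫ x, Real.exp (-(|x| ^ α) / α) * f x) / Zalpha α - a)]

end Weight

end

/-- For `α > 1` the Muckenhoupt quantity of `μ_α` is bounded by `α^{2/α} Γ(1+1/α)²`, and
consequently `Var_{μ_α}(f) ≤ 4 α^{2/α} Γ(1+1/α)² ∫ (f')² dμ_α`, i.e.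
`λ₁ ≥ 1/(4 α^{2/α} Γ(1+1/α)²)`. -/
theorem muckenhoupt_bound_exponential_power (α : ℝ) (hα : 1 < α) :
    (∀ x : ℝ, 0 ≤ x →
      (∫ y in Set.Ioi x, Real.exp (-(y ^ α) / α)) * (∫ y in (0:ℝ)..x, Real.exp (y ^ α / α))
        ≤ α ^ (2 / α) * Real.Gamma (1 + 1 / α) ^ 2)
    ∧ (∀ f : ℝ → ℝ, ContDiff ℝ (⊤ : ℕ∞) f → HasCompactSupport f →
        varMu (muAlpha α) f
          ≤ 4 * α ^ (2 / α) * Real.Gamma (1 + 1 / α) ^ 2 *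
              ∫ x, deriv f x ^ 2 ∂(muAlpha α)) := by
  have h0 : 0 < α := by linarith
  have hsq : (α ^ (1 / α) * Real.Gamma (1 + 1 / α)) ^ 2
      = α ^ (2 / α) * Real.Gamma (1 + 1 / α) ^ 2 := by
    rw [mul_pow, ← Real.rpow_natCast (α ^ (1 / α)), ← Real.rpow_mul h0.le]
    congr 2
    push_cast
    ring
  have hc0 : 0 ≤ α ^ (1 / α) * Real.Gamma (1 + 1 / α) :=
    (integral_Ioi_exp_neg_rpow hα).symm ▸ (integral_Ioi_exp_neg_rpow_pos hα).le
  constructor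
  · intro x hx
    have hG : 0 ≤ ∫ y in (0:ℝ)..x, Real.exp (y ^ α / α) :=
      intervalIntegral.integral_nonneg hx fun y _ => (Real.exp_pos _).le
    rw [← hsq]
    calc _ ≤ Real.exp (-(x ^ α) / α) * (α ^ (1 / α) * Real.Gamma (1 + 1 / α))
          * ∫ y in (0:ℝ)..x, Real.exp (y ^ α / α) :=
        mul_le_mul_of_nonneg_right (integral_Ioi_exp_neg_rpow_le hα hx) hG
      _ = (α ^ (1 / α) * Real.Gamma (1 + 1 / α))
          * (Real.exp (-(x ^ α) / α) * ∫ y in (0:ℝ)..x, Real.exp (y ^ α / α)) := by ring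
      _ ≤ _ := by
        rw [sq]
        exact mul_le_mul_of_nonneg_left (exp_neg_rpow_mul_integral_le hα hx) hc0
  · intro f hf hcs
    refine (varMu_muAlpha_le hα hf.continuous hcs (f 0)).trans ?_
    rw [integral_muAlpha hα, integral_muAlpha hα, mul_assoc 4, ← hsq, ← mul_div_assoc]
    refine div_le_div_of_nonneg_right ?_ (Zalpha_pos hα).le
    refine integral_sub_sq_le_of_even (continuous_exp_neg_abs_rpow hα) (fun x => Real.exp_pos _)
      (fun x => by rw [abs_neg]) (integrable_exp_neg_abs_rpow hα) (fun x hx => ?_)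
      (hf.of_le (by exact_mod_cast le_top)) hcs
    refine le_of_eq_of_le ?_ (exp_neg_rpow_mul_integral_le hα hx)
    rw [abs_of_nonneg hx]
    congr 1
    refine intervalIntegral.integral_congr fun y hy => ?_
    rw [Set.uIcc_of_le hx] at hy
    simp only [← Real.exp_neg, abs_of_nonneg hy.1, neg_div, neg_neg]
end

section
/- Let μ be the probability measure on ℝ with density proportional to e^{−x⁴/4}. Then the Poincaré inequality √(3/2) · Var_μ(f) ≤ ∫_ℝ f'(x)² dμ(x) holds for every smooth compactly supported f : ℝ → ℝ; that is, the spectral gap of the operator L f = f'' − x³ f' satisfies λ₁ ≥ √(3/2). -/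
open MeasureTheory

/-- Normalization constant `Z = ∫ e^{−x⁴/4} dx`. -/
noncomputable def Zquartic : ℝ := ∫ x : ℝ, Real.exp (-x ^ 4 / 4)

/-- The probability measure on `ℝ` with density proportional to `e^{−x⁴/4}`, reversible
for `L f = f'' − x³ f'`. -/
noncomputable def muQuartic : Measure ℝ :=
  volume.withDensity (fun x => ENNReal.ofReal (Real.exp (-x ^ 4 / 4) / Zquartic))

theorem integrable_exp_neg_quartic : Integrable (fun x : ℝ => Real.exp (-x ^ 4 / 4)) := by
  have h := (integrable_exp_neg_mul_sq (b := 1 / 2) (by norm_num)).const_mul (Real.exp (1 / 4))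
  refine h.mono' (by fun_prop) (Filter.Eventually.of_forall fun x => ?_)
  rw [Real.norm_eq_abs, Real.abs_exp, ← Real.exp_add]
  apply Real.exp_le_exp.mpr
  nlinarith [sq_nonneg (x ^ 2 - 1)]

theorem Zquartic_pos : 0 < Zquartic := integral_exp_pos integrable_exp_neg_quartic

theorem integral_muQuartic (g : ℝ → ℝ) :
    ∫ x, g x ∂muQuartic = (∫ x, Real.exp (-x ^ 4 / 4) * g x) / Zquartic := by
  have hnn : ∀ x : ℝ, 0 ≤ Real.exp (-x ^ 4 / 4) / Zquartic := fun x =>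
    div_nonneg (Real.exp_pos _).le Zquartic_pos.le
  rw [muQuartic, integral_withDensity_eq_integral_toReal_smul (by fun_prop)
    (Filter.Eventually.of_forall fun x => ENNReal.ofReal_lt_top), ← integral_div]
  refine integral_congr_ae (Filter.Eventually.of_forall fun x => ?_)
  simp only [ENNReal.toReal_ofReal (hnn x), smul_eq_mul]
  ring

/-- The weight `x + x³ / (2√(3/2))`, whose inverse is the drift in the Hardy-type inequality. -/
noncomputable def hardyWeight (x : ℝ) : ℝ := x * (1 + x ^ 2 / (2 * √(3 / 2)))

theorem hardyWeight_ne_zero {x : ℝ} (hx : x ≠ 0) : hardyWeight x ≠ 0 :=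
  mul_ne_zero hx (by positivity)

theorem hasDerivAt_hardyWeight (x : ℝ) :
    HasDerivAt hardyWeight (1 + √(3 / 2) * x ^ 2) x := by
  have hs : √(3 / 2 : ℝ) ^ 2 = 3 / 2 := Real.sq_sqrt (by norm_num)
  have hs0 : √(3 / 2 : ℝ) ≠ 0 := by positivity
  have h := (hasDerivAt_id x).mul
    ((((hasDerivAt_id x).pow 2).div_const (2 * √(3 / 2))).const_add 1)
  refine h.congr_deriv ?_
  simp only [id, Pi.pow_apply]
  field_simp
  push_cast
  linear_combination (-2 * x ^ 2) * hs

/-- The boundary term `e^{−x⁴/4} (f x − f 0)² / (x + x³ / (2√(3/2)))`. -/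
noncomputable def hardyBoundary (f : ℝ → ℝ) (x : ℝ) : ℝ :=
  Real.exp (-x ^ 4 / 4) * ((f x - f 0) ^ 2 / hardyWeight x)

theorem continuous_hardyBoundary {f : ℝ → ℝ} (hf : Differentiable ℝ f) :
    Continuous (hardyBoundary f) := by
  have hd : Continuous (dslope f 0) := by
    rw [continuous_iff_continuousAt]
    intro x
    rcases eq_or_ne x 0 with rfl | hx
    · exact continuousAt_dslope_same.mpr (hf 0)
    · exact (continuousAt_dslope_of_ne hx).mpr (hf x).continuousAt
  have hfc := hf.continuous
  have heq : hardyBoundary f = fun x => Real.exp (-x ^ 4 / 4) *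
      (dslope f 0 x * (f x - f 0) / (1 + x ^ 2 / (2 * √(3 / 2)))) := by
    funext x
    rcases eq_or_ne x 0 with rfl | hx
    · simp [hardyBoundary]
    · have h := sub_smul_dslope f 0 x
      rw [sub_zero, smul_eq_mul] at h
      have : 1 + x ^ 2 / (2 * √(3 / 2)) ≠ 0 := by positivity
      rw [hardyBoundary, hardyWeight, ← h]
      congr 1
      rw [div_eq_div_iff (mul_ne_zero hx this) this]
      ring
  rw [heq]
  have h0 : ∀ x : ℝ, 1 + x ^ 2 / (2 * √(3 / 2)) ≠ 0 := fun x => by positivity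
  fun_prop (disch := exact h0 _)

theorem hasDerivAt_hardyBoundary {f : ℝ → ℝ} (hf : Differentiable ℝ f) {x : ℝ} (hx : x ≠ 0) :
    HasDerivAt (hardyBoundary f)
      (Real.exp (-x ^ 4 / 4) * (2 * (f x - f 0) * deriv f x / hardyWeight x
        - (f x - f 0) ^ 2 * ((1 + √(3 / 2) * x ^ 2) / hardyWeight x ^ 2 + x ^ 3 / hardyWeight x)))
      x := by
  have hp := hardyWeight_ne_zero hx
  have he : HasDerivAt (fun y : ℝ => Real.exp (-y ^ 4 / 4))
      (Real.exp (-x ^ 4 / 4) * (-x ^ 3)) x := by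
    refine ((((hasDerivAt_id x).pow 4).neg.div_const 4).exp).congr_deriv ?_
    simp only [id, Pi.pow_apply, Pi.neg_apply]
    push_cast
    ring
  have hu := ((hf x).hasDerivAt.sub_const (f 0)).pow 2
  refine (he.mul (hu.div (hasDerivAt_hardyWeight x) hp)).congr_deriv ?_
  simp only [Pi.pow_apply, Pi.div_apply]
  field_simp
  push_cast
  ring

theorem hardyWeight_drift_bound {x : ℝ} (hx : x ≠ 0) :
    √(3 / 2) + (1 / hardyWeight x) ^ 2 ≤
      (1 + √(3 / 2) * x ^ 2) / hardyWeight x ^ 2 + x ^ 3 / hardyWeight x := by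
  have hp := hardyWeight_ne_zero hx
  have hs0 : 0 < √(3 / 2 : ℝ) := by positivity
  rw [← sub_nonneg]
  have key : (1 + √(3 / 2) * x ^ 2) / hardyWeight x ^ 2 + x ^ 3 / hardyWeight x
      - (√(3 / 2) + (1 / hardyWeight x) ^ 2) =
      x ^ 6 / (4 * √(3 / 2)) / hardyWeight x ^ 2 := by
    field_simp
    rw [hardyWeight]
    field_simp
    ring
  rw [key]
  positivity

theorem deriv_hardyBoundary_le (f : ℝ → ℝ) {x : ℝ} (hx : x ≠ 0) :
    Real.exp (-x ^ 4 / 4) * (2 * (f x - f 0) * deriv f x / hardyWeight x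
        - (f x - f 0) ^ 2 * ((1 + √(3 / 2) * x ^ 2) / hardyWeight x ^ 2 + x ^ 3 / hardyWeight x)) ≤
      Real.exp (-x ^ 4 / 4) * (deriv f x ^ 2 - √(3 / 2) * (f x - f 0) ^ 2) := by
  refine mul_le_mul_of_nonneg_left ?_ (Real.exp_pos _).le
  have h1 := mul_le_mul_of_nonneg_left (hardyWeight_drift_bound hx) (sq_nonneg (f x - f 0))
  have h2 := sq_nonneg (deriv f x - (f x - f 0) * (1 / hardyWeight x))
  have h3 : 2 * (f x - f 0) * deriv f x / hardyWeight x =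
    2 * (f x - f 0) * deriv f x * (1 / hardyWeight x) := by ring
  rw [h3]
  nlinarith

theorem hardyBoundary_sub_le {f : ℝ → ℝ} (hf : ContDiff ℝ 1 f) {a b : ℝ} (hab : a ≤ b)
    (h0 : (0 : ℝ) ∉ Set.Ioo a b) :
    hardyBoundary f b - hardyBoundary f a ≤
      ∫ x in a..b, Real.exp (-x ^ 4 / 4) * (deriv f x ^ 2 - √(3 / 2) * (f x - f 0) ^ 2) := by
  have hd : Differentiable ℝ f := hf.differentiable (by norm_num)
  have hc := hf.continuous
  have hc' := hf.continuous_deriv (by norm_num)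
  have hne : ∀ x ∈ Set.Ioo a b, x ≠ 0 := fun x hx h => h0 (h ▸ hx)
  exact intervalIntegral.sub_le_integral_of_hasDeriv_right_of_le hab
    (continuous_hardyBoundary hd).continuousOn
    (fun x hx => (hasDerivAt_hardyBoundary hd (hne x hx)).hasDerivWithinAt)
    (Continuous.integrableOn_Icc (by fun_prop))
    (fun x hx => deriv_hardyBoundary_le f (hne x hx))

theorem integral_quartic_hardy_nonneg {f : ℝ → ℝ} (hf : ContDiff ℝ 1 f)
    (hint : Integrable fun x : ℝ =>
      Real.exp (-x ^ 4 / 4) * (deriv f x ^ 2 - √(3 / 2) * (f x - f 0) ^ 2)) :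
    0 ≤ ∫ x : ℝ, Real.exp (-x ^ 4 / 4) * (deriv f x ^ 2 - √(3 / 2) * (f x - f 0) ^ 2) := by
  refine ge_of_tendsto (intervalIntegral_tendsto_integral hint Filter.tendsto_neg_atTop_atBot
    Filter.tendsto_id) ?_
  filter_upwards [Filter.eventually_ge_atTop 0] with R hR
  rw [id, ← intervalIntegral.integral_add_adjacent_intervals (b := 0)
    hint.intervalIntegrable hint.intervalIntegrable]
  have hB0 : hardyBoundary f 0 = 0 := by simp [hardyBoundary]
  have hBR : 0 ≤ hardyBoundary f R := by
    unfold hardyBoundary hardyWeight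
    positivity
  have hBn : hardyBoundary f (-R) ≤ 0 := by
    have : hardyBoundary f (-R) =
        -(Real.exp (-R ^ 4 / 4) * ((f (-R) - f 0) ^ 2 / hardyWeight R)) := by
      simp only [hardyBoundary, hardyWeight, Even.neg_pow (show Even 4 by decide), neg_sq,
        neg_mul, div_neg, mul_neg]
    rw [this, neg_nonpos]
    unfold hardyWeight
    positivity
  have h1 := hardyBoundary_sub_le hf (neg_nonpos.mpr hR) (by simp)
  have h2 := hardyBoundary_sub_le hf hR (by simp)
  linarith

/-- Poincaré inequality for the quartic potential: the spectral gap of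
`L f = f'' − x³ f'` is at least `√(3/2)`. -/
theorem poincare_quartic :
    ∀ f : ℝ → ℝ, ContDiff ℝ (⊤ : ℕ∞) f → HasCompactSupport f →
      Real.sqrt (3 / 2) * varMu muQuartic f ≤ ∫ x, deriv f x ^ 2 ∂muQuartic := by
  intro f hf hsupp
  have hf1 : ContDiff ℝ 1 f := hf.of_le (by exact_mod_cast le_top)
  have hc := hf1.continuous
  have hc' := hf1.continuous_deriv (by norm_num)
  have i0 := integrable_exp_neg_quartic
  have i1 : Integrable fun x : ℝ => Real.exp (-x ^ 4 / 4) * f x :=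
    Continuous.integrable_of_hasCompactSupport (by fun_prop) hsupp.mul_left
  have i2 : Integrable fun x : ℝ => Real.exp (-x ^ 4 / 4) * f x ^ 2 := by
    refine Continuous.integrable_of_hasCompactSupport (by fun_prop) (HasCompactSupport.mul_left ?_)
    exact hsupp.comp_left (g := fun y : ℝ => y ^ 2) (by simp)
  have i3 : Integrable fun x : ℝ => Real.exp (-x ^ 4 / 4) * deriv f x ^ 2 := by
    refine Continuous.integrable_of_hasCompactSupport (by fun_prop) (HasCompactSupport.mul_left ?_)
    exact hsupp.deriv.comp_left (g := fun y : ℝ => y ^ 2) (by simp)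
  have heq : (fun x : ℝ =>
      Real.exp (-x ^ 4 / 4) * (deriv f x ^ 2 - √(3 / 2) * (f x - f 0) ^ 2)) =
      fun x => Real.exp (-x ^ 4 / 4) * deriv f x ^ 2
        - √(3 / 2) * (Real.exp (-x ^ 4 / 4) * f x ^ 2
          - 2 * f 0 * (Real.exp (-x ^ 4 / 4) * f x) + f 0 ^ 2 * Real.exp (-x ^ 4 / 4)) := by
    funext x
    ring
  have i4 : Integrable fun x : ℝ => Real.exp (-x ^ 4 / 4) * f x ^ 2
      - 2 * f 0 * (Real.exp (-x ^ 4 / 4) * f x) := i2.sub (i1.const_mul (2 * f 0))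
  have i5 : Integrable fun x : ℝ => Real.exp (-x ^ 4 / 4) * f x ^ 2
      - 2 * f 0 * (Real.exp (-x ^ 4 / 4) * f x) + f 0 ^ 2 * Real.exp (-x ^ 4 / 4) :=
    i4.add (i0.const_mul (f 0 ^ 2))
  have hnn := integral_quartic_hardy_nonneg hf1 (heq ▸ i3.sub (i5.const_mul (√(3 / 2))))
  rw [heq, integral_sub i3 (i5.const_mul (√(3 / 2))), integral_const_mul,
    integral_add i4 (i0.const_mul (f 0 ^ 2)),
    integral_sub i2 (i1.const_mul (2 * f 0)), integral_const_mul, integral_const_mul,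
    ← Zquartic] at hnn
  have hZ := Zquartic_pos
  rw [varMu, integral_muQuartic, integral_muQuartic, integral_muQuartic]
  set A := ∫ x : ℝ, Real.exp (-x ^ 4 / 4) * f x ^ 2
  set B := ∫ x : ℝ, Real.exp (-x ^ 4 / 4) * f x
  set C := ∫ x : ℝ, Real.exp (-x ^ 4 / 4) * deriv f x ^ 2
  have hle : A / Zquartic - (B / Zquartic) ^ 2 ≤
      (A - 2 * f 0 * B + f 0 ^ 2 * Zquartic) / Zquartic := by
    have : (A - 2 * f 0 * B + f 0 ^ 2 * Zquartic) / Zquartic =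
        A / Zquartic - (B / Zquartic) ^ 2 + (B / Zquartic - f 0) ^ 2 := by
      field_simp
      ring
    rw [this]
    exact le_add_of_nonneg_right (sq_nonneg _)
  calc √(3 / 2) * (A / Zquartic - (B / Zquartic) ^ 2)
      ≤ √(3 / 2) * ((A - 2 * f 0 * B + f 0 ^ 2 * Zquartic) / Zquartic) :=
        mul_le_mul_of_nonneg_left hle (Real.sqrt_nonneg _)
    _ = √(3 / 2) * (A - 2 * f 0 * B + f 0 ^ 2 * Zquartic) / Zquartic := by ring
    _ ≤ C / Zquartic := div_le_div_of_nonneg_right (by linarith) hZ.le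
end

section
/- (Double-well potential.) Let 0 < β < √6 and let μ_β be the probability measure on ℝ with density proportional to e^{−(x⁴/4 − βx²/2)}. Then the Poincaré inequality (√(3/2) − β/2) · Var_{μ_β}(f) ≤ ∫_ℝ f'(x)² dμ_β(x) holds for every smooth compactly supported f : ℝ → ℝ; that is, the spectral gap of the operator L f = f'' − (x³ − βx) f' satisfies λ₁ ≥ √(3/2) − β/2 > 0. -/
open MeasureTheory

/-- Normalization constant `Z = ∫ e^{−(x⁴/4 − βx²/2)} dx` for the double-well
potential. -/
noncomputable def Zdw (β : ℝ) : ℝ := ∫ x : ℝ, Real.exp (-(x ^ 4 / 4 - β * x ^ 2 / 2))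

/-- The probability measure on `ℝ` with density proportional to `e^{−(x⁴/4 − βx²/2)}`,
reversible for `L f = f'' − (x³ − βx) f'`. -/
noncomputable def muDW (β : ℝ) : Measure ℝ :=
  volume.withDensity
    (fun x => ENNReal.ofReal (Real.exp (-(x ^ 4 / 4 - β * x ^ 2 / 2)) / Zdw β))

/-- The unnormalized density `e^{−(x⁴/4 − βx²/2)}`. -/
noncomputable def dwWeight (β x : ℝ) : ℝ := Real.exp (-(x ^ 4 / 4 - β * x ^ 2 / 2))

lemma dwWeight_pos (β x : ℝ) : 0 < dwWeight β x := Real.exp_pos _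

lemma dwWeight_neg (β x : ℝ) : dwWeight β (-x) = dwWeight β x := by
  simp only [dwWeight]
  ring_nf

lemma continuous_dwWeight (β : ℝ) : Continuous (dwWeight β) := by
  unfold dwWeight
  fun_prop

lemma hasDerivAt_dwWeight (β x : ℝ) :
    HasDerivAt (dwWeight β) (-(x ^ 3 - β * x) * dwWeight β x) x := by
  have h : HasDerivAt (fun x : ℝ => -(x ^ 4 / 4 - β * x ^ 2 / 2)) (-(x ^ 3 - β * x)) x := by
    refine ((((hasDerivAt_id' x).pow 4).div_const 4).sub
      ((((hasDerivAt_id' x).pow 2).const_mul β).div_const 2)).neg.congr_deriv ?_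
    norm_num
    ring
  refine h.exp.congr_deriv ?_
  rw [dwWeight]
  ring

lemma dwWeight_le_gaussian (β x : ℝ) :
    dwWeight β x ≤ Real.exp ((β / 2 + 1) ^ 2) * Real.exp (-1 * x ^ 2) := by
  rw [dwWeight, ← Real.exp_add]
  apply Real.exp_le_exp.2
  nlinarith [sq_nonneg (x ^ 2 / 2 - (β / 2 + 1))]

lemma integrable_dwWeight (β : ℝ) : Integrable (dwWeight β) := by
  refine ((integrable_exp_neg_mul_sq one_pos).const_mul (Real.exp ((β / 2 + 1) ^ 2))).mono'
    (continuous_dwWeight β).aestronglyMeasurable (.of_forall fun x => ?_)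
  rw [Real.norm_of_nonneg (dwWeight_pos β x).le]
  exact dwWeight_le_gaussian β x

lemma Zdw_eq (β : ℝ) : Zdw β = ∫ x, dwWeight β x := rfl

lemma Zdw_pos (β : ℝ) : 0 < Zdw β := by
  rw [Zdw_eq, integral_pos_iff_support_of_nonneg (fun x => (dwWeight_pos β x).le)
    (integrable_dwWeight β)]
  have : Function.support (dwWeight β) = Set.univ :=
    Set.eq_univ_of_forall fun x => (dwWeight_pos β x).ne'
  simp [this]

lemma integral_muDW (β : ℝ) (g : ℝ → ℝ) :
    ∫ x, g x ∂(muDW β) = (∫ x, g x * dwWeight β x) / Zdw β := by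
  have hm : Measurable fun x => dwWeight β x / Zdw β :=
    (continuous_dwWeight β).measurable.div_const _
  change ∫ x, g x ∂(volume.withDensity fun x => ENNReal.ofReal (dwWeight β x / Zdw β)) = _
  rw [integral_withDensity_eq_integral_toReal_smul hm.ennreal_ofReal
    (.of_forall fun x => ENNReal.ofReal_lt_top), ← integral_div]
  refine integral_congr_ae (.of_forall fun x => ?_)
  simp only [smul_eq_mul]
  rw [ENNReal.toReal_ofReal (div_nonneg (dwWeight_pos β x).le (Zdw_pos β).le)]
  ring

lemma tendsto_dwWeight_atTop (β : ℝ) :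
    Filter.Tendsto (dwWeight β) Filter.atTop (nhds 0) := by
  have h1 : Filter.Tendsto (fun x : ℝ => -1 * x ^ 2) Filter.atTop Filter.atBot :=
    (Filter.tendsto_pow_atTop two_ne_zero).const_mul_atTop_of_neg (by norm_num)
  have h2 := (Real.tendsto_exp_atBot.comp h1).const_mul (Real.exp ((β / 2 + 1) ^ 2))
  rw [mul_zero] at h2
  exact squeeze_zero (fun x => (dwWeight_pos β x).le) (dwWeight_le_gaussian β) h2

lemma integral_Ioi_mul_le_dwWeight {β R : ℝ} (hR : 0 < R) (hRβ : β ≤ R ^ 2) :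
    (R ^ 3 - β * R) * ∫ x in Set.Ioi R, dwWeight β x ≤ dwWeight β R := by
  have hd : ∀ x ∈ Set.Ici R,
      HasDerivAt (dwWeight β) (-(x ^ 3 - β * x) * dwWeight β x) x :=
    fun x _ => hasDerivAt_dwWeight β x
  have hmono : ∀ x ∈ Set.Ioi R, R ^ 3 - β * R ≤ x ^ 3 - β * x := by
    intro x hx
    have hx : R < x := hx
    nlinarith [mul_nonneg (sub_nonneg.2 hx.le) (sub_nonneg.2 hRβ), mul_pos hR (sub_pos.2 hx),
      mul_nonneg (sub_nonneg.2 hx.le) (mul_pos (hR.trans hx) (hR.trans hx)).le,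
      mul_nonneg (sub_nonneg.2 hx.le) (mul_pos hR (hR.trans hx)).le]
  have hnn : 0 ≤ R ^ 3 - β * R := by nlinarith
  have hneg : ∀ x ∈ Set.Ioi R, -(x ^ 3 - β * x) * dwWeight β x ≤ 0 := fun x hx => by
    nlinarith [mul_nonneg (hnn.trans (hmono x hx)) (dwWeight_pos β x).le]
  have hlim := tendsto_dwWeight_atTop β
  have hint := integrableOn_Ioi_deriv_of_nonpos' hd hneg hlim
  have hval := integral_Ioi_of_hasDerivAt_of_nonpos' hd hneg hlim
  rw [← integral_const_mul]
  calc ∫ x in Set.Ioi R, (R ^ 3 - β * R) * dwWeight β x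
      ≤ ∫ x in Set.Ioi R, -(-(x ^ 3 - β * x) * dwWeight β x) := by
        refine setIntegral_mono_on ((integrable_dwWeight β).integrableOn.const_mul _) hint.neg
          measurableSet_Ioi fun x hx => ?_
        nlinarith [mul_le_mul_of_nonneg_right (hmono x hx) (dwWeight_pos β x).le]
    _ = dwWeight β R := by rw [integral_neg, hval]; ring

/-- Boundary estimate for the supersolution at infinity. -/
lemma mul_integral_Ioi_le_dwWeight {β c R : ℝ} (hR : 0 < R) (hc : 0 ≤ c)
    (hRβ : β + 2 * c ≤ R ^ 2) :
    ((R ^ 3 - β * R) / 2 + c * R) * ∫ x in Set.Ioi R, dwWeight β x ≤ dwWeight β R := by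
  refine le_trans ?_ (integral_Ioi_mul_le_dwWeight hR (by linarith : β ≤ R ^ 2))
  refine mul_le_mul_of_nonneg_right ?_
    (setIntegral_nonneg measurableSet_Ioi fun x _ => (dwWeight_pos β x).le)
  nlinarith

/-- The antiderivative `x ↦ -∫_{-∞}^x g`. -/
lemma hasDerivAt_neg_integral_Iic {g : ℝ → ℝ} (hg : Integrable g) (hc : Continuous g) (x : ℝ) :
    HasDerivAt (fun x => -∫ y in Set.Iic x, g y) (-g x) x := by
  have h := (intervalIntegral.integral_hasDerivAt_right (hc.intervalIntegrable 0 x)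
    (hc.stronglyMeasurableAtFilter _ _) hc.continuousAt).const_add (∫ y in Set.Iic (0 : ℝ), g y)
  refine (h.congr_of_eventuallyEq (.of_forall fun z => ?_)).neg
  simp only [← intervalIntegral.integral_Iic_sub_Iic hg.integrableOn hg.integrableOn]
  ring

/-- The boundary functional whose derivative is dominated by the Dirichlet form. -/
noncomputable def dwFlux (β c m : ℝ) (f G : ℝ → ℝ) (x : ℝ) : ℝ :=
  -((x ^ 3 - β * x) / 2 + c * x) * G x ^ 2 / dwWeight β x + G x * (f x - m)

lemma hasDerivAt_dwFlux {β c m f' x : ℝ} {f G : ℝ → ℝ} (hf : HasDerivAt f f' x)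
    (hG : HasDerivAt G (-((f x - m) * dwWeight β x)) x) :
    HasDerivAt (dwFlux β c m f G)
      (f' * G x - (c - β / 2 + (3 / 2 - c ^ 2) * x ^ 2) * G x ^ 2 / dwWeight β x
        - ((f x - m) * dwWeight β x - ((x ^ 3 - β * x) / 2 + c * x) * G x) ^ 2 / dwWeight β x
        - (x ^ 3 - β * x) ^ 2 / 4 * G x ^ 2 / dwWeight β x) x := by
  have hp := (dwWeight_pos β x).ne'
  have hU : HasDerivAt (fun x : ℝ => -((x ^ 3 - β * x) / 2 + c * x))
      (-((3 * x ^ 2 - β) / 2 + c)) x := by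
    refine ((((((hasDerivAt_id' x).pow 3).sub ((hasDerivAt_id' x).const_mul β)).div_const 2).add
      ((hasDerivAt_id' x).const_mul c)).neg).congr_deriv ?_
    norm_num
  refine (((hU.mul (hG.pow 2)).div (hasDerivAt_dwWeight β x) hp).add
    (hG.mul (hf.sub_const m))).congr_deriv ?_
  simp only [Pi.mul_apply, Pi.pow_apply]
  field_simp
  norm_num
  ring

/-- The Poincaré inequality with respect to the unnormalized weight. -/
lemma poincare_dwWeight {β c m : ℝ} (hc : 0 ≤ c) (hc2 : c ^ 2 = 3 / 2) (hK : 0 ≤ c - β / 2)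
    {f : ℝ → ℝ} (hf : ContDiff ℝ 1 f) (hs : HasCompactSupport f)
    (hm : ∫ x, f x * dwWeight β x = m * Zdw β) :
    (c - β / 2) * ∫ x, f x * ((f x - m) * dwWeight β x) ≤
      ∫ x, deriv f x ^ 2 * dwWeight β x := by
  have hpc := continuous_dwWeight β
  have hfc := hf.continuous
  have hf'c : Continuous (deriv f) := hf.continuous_deriv le_rfl
  have hfd : ∀ x, HasDerivAt f (deriv f x) x :=
    fun x => (hf.differentiable one_ne_zero x).hasDerivAt
  obtain ⟨R, hR1, hR2, hsupp⟩ : ∃ R : ℝ, 0 < R ∧ β + 2 * c ≤ R ^ 2 ∧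
      tsupport f ⊆ Set.Ioo (-R) R := by
    obtain ⟨r, hr⟩ := hs.isCompact.isBounded.subset_closedBall 0
    refine ⟨1 + |β| + 2 * c + |r|, by positivity, ?_, fun x hx => ?_⟩
    · nlinarith [abs_nonneg β, abs_nonneg r, le_abs_self β]
    · have hx := hr hx
      rw [mem_closedBall_zero_iff, Real.norm_eq_abs] at hx
      rw [Set.mem_Ioo, ← abs_lt]
      linarith [abs_nonneg β, le_abs_self r]
  have hf0 : ∀ x, x ∉ Set.Ioo (-R) R → f x = 0 :=
    fun x hx => image_eq_zero_of_notMem_tsupport fun h => hx (hsupp h)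
  have hf'0 : ∀ x, x ∉ Set.Ioo (-R) R → deriv f x = 0 :=
    fun x hx => by
      by_contra h
      exact hx (hsupp (support_deriv_subset h))
  set g : ℝ → ℝ := fun x => (f x - m) * dwWeight β x with hg
  have hgc : Continuous g := (hfc.sub continuous_const).mul hpc
  have hfp : Integrable fun x => f x * dwWeight β x :=
    (hfc.mul hpc).integrable_of_hasCompactSupport hs.mul_right
  have hgi : Integrable g := by
    simp only [hg, sub_mul]
    exact hfp.sub ((integrable_dwWeight β).const_mul m)
  have hg0 : ∫ x, g x = 0 := by
    simp only [hg, sub_mul]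
    rw [integral_sub hfp ((integrable_dwWeight β).const_mul m), integral_const_mul, hm, Zdw_eq,
      sub_self]
  set G : ℝ → ℝ := fun x => -∫ y in Set.Iic x, g y with hGdef
  have hG : ∀ x, HasDerivAt G (-g x) x := hasDerivAt_neg_integral_Iic hgi hgc
  have hGc : Continuous G := continuous_iff_continuousAt.2 fun x => (hG x).continuousAt
  set T := ∫ x in Set.Ioi R, dwWeight β x with hT
  have hT0 : 0 ≤ T := setIntegral_nonneg measurableSet_Ioi fun x _ => (dwWeight_pos β x).le
  have hTle := mul_integral_Ioi_le_dwWeight hR1 hc hR2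
  rw [← hT] at hTle
  have hGR : G R = -(m * T) := by
    have h1 := intervalIntegral.integral_Iic_add_Ioi (b := R) hgi.integrableOn hgi.integrableOn
    have h2 : ∫ x in Set.Ioi R, g x = -(m * T) := by
      rw [hT, ← integral_const_mul, ← integral_neg]
      refine setIntegral_congr_fun measurableSet_Ioi fun x hx => ?_
      simp only [hg, hf0 x fun h => lt_asymm h.2 hx]
      ring
    simp only [hGdef]
    linarith
  have hGR' : G (-R) = m * T := by
    simp only [hGdef]
    rw [hT, ← integral_const_mul, ← integral_neg, ← integral_comp_neg_Ioi R]
    refine setIntegral_congr_fun measurableSet_Ioi fun x hx => ?_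
    simp only [hg, hf0 (-x) fun h => lt_asymm hx (neg_lt_neg_iff.1 h.1), dwWeight_neg]
    ring
  have hpR := dwWeight_pos β R
  have hratio : 0 ≤ 1 - ((R ^ 3 - β * R) / 2 + c * R) * T / dwWeight β R := by
    rw [sub_nonneg, div_le_one hpR]
    exact hTle
  have hprod : 0 ≤ m ^ 2 * T * (1 - ((R ^ 3 - β * R) / 2 + c * R) * T / dwWeight β R) :=
    mul_nonneg (mul_nonneg (sq_nonneg m) hT0) hratio
  have hBR : 0 ≤ dwFlux β c m f G R := by
    rw [dwFlux, hGR, hf0 R (by simp)]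
    convert hprod using 1
    ring
  have hBR' : dwFlux β c m f G (-R) ≤ 0 := by
    rw [dwFlux, hGR', hf0 (-R) (by simp), dwWeight_neg]
    rw [← neg_nonneg]
    convert hprod using 1
    ring
  have hB := fun x => hasDerivAt_dwFlux (β := β) (c := c) (m := m) (hfd x) (hG x)
  have hp0 : ∀ x, dwWeight β x ≠ 0 := fun x => (dwWeight_pos β x).ne'
  have hBc : Continuous (deriv (dwFlux β c m f G)) := by
    rw [show deriv (dwFlux β c m f G) = _ from funext fun x => (hB x).deriv]
    fun_prop (disch := exact hp0 _)
  have hflux : ∫ x in (-R)..R, deriv (dwFlux β c m f G) x =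
      dwFlux β c m f G R - dwFlux β c m f G (-R) :=
    intervalIntegral.integral_deriv_eq_sub (fun x _ => (hB x).differentiableAt)
      (hBc.intervalIntegrable _ _)
  have hparts : ∫ x in (-R)..R, deriv f x * G x = ∫ x in (-R)..R, f x * g x := by
    have := intervalIntegral.integral_mul_deriv_eq_deriv_mul (a := -R) (b := R) (u := f) (v := G)
      (fun x _ => hfd x) (fun x _ => hG x) (hf'c.intervalIntegrable _ _)
      (hgc.neg.intervalIntegrable _ _)
    rw [hf0 R (by simp), hf0 (-R) (by simp)] at this
    simp only [mul_neg, intervalIntegral.integral_neg] at this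
    linarith
  have hpoint : ∀ x, (c - β / 2) * (deriv f x * G x) + (c - β / 2) * deriv (dwFlux β c m f G) x ≤
      deriv f x ^ 2 * dwWeight β x := by
    intro x
    rw [(hB x).deriv, hc2, ← sub_nonneg]
    have hp := dwWeight_pos β x
    have h : 0 ≤ (deriv f x * dwWeight β x - (c - β / 2) * G x) ^ 2 / dwWeight β x
        + (c - β / 2) * (((f x - m) * dwWeight β x
          - ((x ^ 3 - β * x) / 2 + c * x) * G x) ^ 2 / dwWeight β x
        + (x ^ 3 - β * x) ^ 2 / 4 * G x ^ 2 / dwWeight β x) := by positivity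
    convert h using 1
    field_simp
    ring
  have hmono : ∫ x in (-R)..R, ((c - β / 2) * (deriv f x * G x)
      + (c - β / 2) * deriv (dwFlux β c m f G) x) ≤
      ∫ x in (-R)..R, deriv f x ^ 2 * dwWeight β x :=
    intervalIntegral.integral_mono (by linarith)
      ((by fun_prop : Continuous _).intervalIntegrable _ _)
      ((by fun_prop : Continuous _).intervalIntegrable _ _) hpoint
  rw [intervalIntegral.integral_add ((by fun_prop : Continuous _).intervalIntegrable _ _)
      ((by fun_prop : Continuous _).intervalIntegrable _ _),
    intervalIntegral.integral_const_mul, intervalIntegral.integral_const_mul, hflux, hparts,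
    intervalIntegral.integral_eq_integral_of_support_subset,
    intervalIntegral.integral_eq_integral_of_support_subset] at hmono
  · nlinarith [mul_nonneg hK (sub_nonneg.2 (hBR'.trans hBR))]
  · intro x hx
    by_contra h
    exact hx (by simp [hf'0 x fun h' => h (Set.Ioo_subset_Ioc_self h')])
  · intro x hx
    by_contra h
    exact hx (by simp [hf0 x fun h' => h (Set.Ioo_subset_Ioc_self h')])

/-- Poincaré inequality for the double-well potential with `0 < β < √6`: the spectral
gap of `L f = f'' − (x³ − βx) f'` is at least `√(3/2) − β/2 > 0`. -/
theorem poincare_double_well (β : ℝ) (hβ₀ : 0 < β) (hβ : β < Real.sqrt 6) :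
    0 < Real.sqrt (3 / 2) - β / 2
    ∧ ∀ f : ℝ → ℝ, ContDiff ℝ (⊤ : ℕ∞) f → HasCompactSupport f →
        (Real.sqrt (3 / 2) - β / 2) * varMu (muDW β) f
          ≤ ∫ x, deriv f x ^ 2 ∂(muDW β) := by
  have hK : 0 < Real.sqrt (3 / 2) - β / 2 := by
    have h : Real.sqrt 6 = 2 * Real.sqrt (3 / 2) := by
      rw [show (6 : ℝ) = 2 ^ 2 * (3 / 2) by norm_num, Real.sqrt_mul (by norm_num),
        Real.sqrt_sq (by norm_num)]
    linarith
  refine ⟨hK, fun f hf hs => ?_⟩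
  have hZ := Zdw_pos β
  have hpc := continuous_dwWeight β
  have hfc := hf.continuous
  set m := ∫ x, f x ∂(muDW β) with hmdef
  have hm : ∫ x, f x * dwWeight β x = m * Zdw β := by
    rw [hmdef, integral_muDW, div_mul_cancel₀ _ hZ.ne']
  have key := poincare_dwWeight (Real.sqrt_nonneg _) (Real.sq_sqrt (by norm_num)) hK.le
    (hf.of_le (by exact_mod_cast le_top)) hs hm
  have hi1 : Integrable fun x => f x ^ 2 * dwWeight β x := by
    simp only [sq, mul_assoc]
    exact (hfc.mul (hfc.mul hpc)).integrable_of_hasCompactSupport hs.mul_right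
  have hi2 : Integrable fun x => f x * dwWeight β x :=
    (hfc.mul hpc).integrable_of_hasCompactSupport hs.mul_right
  have hvar : ∫ x, f x * ((f x - m) * dwWeight β x) = varMu (muDW β) f * Zdw β := by
    calc ∫ x, f x * ((f x - m) * dwWeight β x)
        = ∫ x, (f x ^ 2 * dwWeight β x - m * (f x * dwWeight β x)) := by
          congr 1 with x
          ring
      _ = varMu (muDW β) f * Zdw β := by
          rw [integral_sub hi1 (hi2.const_mul m), integral_const_mul, hm, varMu, ← hmdef,
            integral_muDW]
          field_simp
  rw [hvar, ← mul_assoc] at key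
  rwa [integral_muDW, le_div_iff₀ hZ]
end
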